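/- arXiv:2104.13416 — 5 statements merged into one kernel-verified Lean document; each statement's English description precedes it below -/
import Mathlib

section
/- Let k ≥ 1 and v = 2k. Let V be the F_2-vector space with basis {α, β, γ} ∪ {z_1, ..., z_v} ∪ {Q_1, ..., Q_v}. Define d : V → V linearly by: d(α) = β + γ; d(β) = Q_1; d(γ) = Q_1; d(z_r) = Q_r for r odd; d(z_r) = z_{r-1} + z_{r+1} + Q_r for r even (with the convention z_{v+1} = 0); d(Q_r) = 0 for r odd; and d(Q_r) = Q_{r-1} + Q_{r+1} for r even (with the convention Q_{v+1} = 0). Then d ∘ d = 0 and the homology ker(d)/range(d) is a one-dimensional F_2-vector space spanned by the class of γ + z_1. -/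
/- The middle summand of the mapping cone for the model complex C₁ has one-dimensional
homology generated by the class of γ + z₁. -/

/-- Basis `{α, β, γ} ∪ {z_1, …, z_v} ∪ {Q_1, …, Q_v}` (with `z r`, `q r` for `r : Fin v`
standing for `z_{r+1}`, `Q_{r+1}`). -/
inductive ConeB (v : ℕ) : Type
  | al | be | ga | z (r : Fin v) | q (r : Fin v)
  deriving DecidableEq

/-- The basis vector `z_r` for `1 ≤ r ≤ v`, extended by `0` outside that range
(convention `z_{v+1} = 0`). -/
def zB (v : ℕ) (r : ℕ) : ConeB v → ZMod 2 :=
  if h : 1 ≤ r ∧ r ≤ v then Pi.single (ConeB.z ⟨r - 1, by omega⟩) 1 else 0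

/-- The basis vector `Q_r` for `1 ≤ r ≤ v`, extended by `0` outside that range
(convention `Q_{v+1} = 0`). -/
def qB (v : ℕ) (r : ℕ) : ConeB v → ZMod 2 :=
  if h : 1 ≤ r ∧ r ≤ v then Pi.single (ConeB.q ⟨r - 1, by omega⟩) 1 else 0

instance (v : ℕ) : Finite (ConeB v) :=
  Finite.of_surjective
    (fun s : Fin 3 ⊕ Fin v ⊕ Fin v =>
      match s with
      | .inl 0 => ConeB.al
      | .inl 1 => ConeB.be
      | .inl 2 => ConeB.ga
      | .inr (.inl r) => ConeB.z r
      | .inr (.inr r) => ConeB.q r)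
    (by
      rintro (_ | _ | _ | r | r)
      exacts [⟨.inl 0, rfl⟩, ⟨.inl 1, rfl⟩, ⟨.inl 2, rfl⟩, ⟨.inr (.inl r), rfl⟩,
        ⟨.inr (.inr r), rfl⟩])

theorem zB_of_not_le {v r : ℕ} (h : ¬ r ≤ v) : zB v r = 0 :=
  dif_neg fun h' => h h'.2

theorem qB_of_not_le {v r : ℕ} (h : ¬ r ≤ v) : qB v r = 0 :=
  dif_neg fun h' => h h'.2

theorem zB_succ {v : ℕ} (r : Fin v) : zB v (r + 1) = Pi.single (ConeB.z r) 1 :=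
  dif_pos ⟨by omega, by omega⟩

theorem qB_succ {v : ℕ} (r : Fin v) : qB v (r + 1) = Pi.single (ConeB.q r) 1 :=
  dif_pos ⟨by omega, by omega⟩

/-- Linear maps out of the cone summand are determined by their values on the basis. -/
theorem coneB_linearMap_ext {v : ℕ} {M : Type*} [AddCommMonoid M] [Module (ZMod 2) M]
    {f g : (ConeB v → ZMod 2) →ₗ[ZMod 2] M}
    (hal : f (Pi.single ConeB.al 1) = g (Pi.single ConeB.al 1))
    (hbe : f (Pi.single ConeB.be 1) = g (Pi.single ConeB.be 1))
    (hga : f (Pi.single ConeB.ga 1) = g (Pi.single ConeB.ga 1))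
    (hz : ∀ r, 1 ≤ r → r ≤ v → f (zB v r) = g (zB v r))
    (hq : ∀ r, 1 ≤ r → r ≤ v → f (qB v r) = g (qB v r)) : f = g := by
  refine LinearMap.pi_ext' fun i => LinearMap.ext_ring ?_
  rcases i with _ | _ | _ | r | r
  · exact hal
  · exact hbe
  · exact hga
  · simpa [zB_succ] using hz (r + 1) (by omega) (by omega)
  · simpa [qB_succ] using hq (r + 1) (by omega) (by omega)

/-- The homotopy `β ↦ α`, `Q_r ↦ z_r`, all other basis vectors `↦ 0`. -/
def coneHomotopy (v : ℕ) : (ConeB v → ZMod 2) →ₗ[ZMod 2] (ConeB v → ZMod 2) where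
  toFun x
    | .al => x .be
    | .be => 0
    | .ga => 0
    | .z r => x (.q r)
    | .q _ => 0
  map_add' x y := by ext (_ | _ | _ | _ | _) <;> simp
  map_smul' c x := by ext (_ | _ | _ | _ | _) <;> simp

theorem coneHomotopy_al (v : ℕ) : coneHomotopy v (Pi.single ConeB.al 1) = 0 := by
  ext (_ | _ | _ | _ | _) <;> simp [coneHomotopy]

theorem coneHomotopy_be (v : ℕ) :
    coneHomotopy v (Pi.single ConeB.be 1) = Pi.single ConeB.al 1 := by
  ext (_ | _ | _ | _ | _) <;> simp [coneHomotopy]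

theorem coneHomotopy_ga (v : ℕ) : coneHomotopy v (Pi.single ConeB.ga 1) = 0 := by
  ext (_ | _ | _ | _ | _) <;> simp [coneHomotopy]

theorem coneHomotopy_zB (v r : ℕ) : coneHomotopy v (zB v r) = 0 := by
  unfold zB
  split_ifs
  · ext (_ | _ | _ | _ | _) <;> simp [coneHomotopy]
  · exact map_zero _

theorem coneHomotopy_qB (v r : ℕ) : coneHomotopy v (qB v r) = zB v r := by
  unfold zB qB
  split_ifs
  · ext (_ | _ | _ | _ | _) <;> simp [coneHomotopy, Pi.single_apply]
  · exact map_zero _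

/-- The functional `β* + γ*`, which detects the homology class of `γ + z_1`. -/
def coneFunctional (v : ℕ) : (ConeB v → ZMod 2) →ₗ[ZMod 2] ZMod 2 :=
  LinearMap.proj (R := ZMod 2) (φ := fun _ : ConeB v => ZMod 2) ConeB.be +
    LinearMap.proj (R := ZMod 2) (φ := fun _ : ConeB v => ZMod 2) ConeB.ga

theorem coneFunctional_al (v : ℕ) : coneFunctional v (Pi.single ConeB.al 1) = 0 := by
  simp [coneFunctional]

theorem coneFunctional_be (v : ℕ) : coneFunctional v (Pi.single ConeB.be 1) = 1 := by
  simp [coneFunctional]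

theorem coneFunctional_ga (v : ℕ) : coneFunctional v (Pi.single ConeB.ga 1) = 1 := by
  simp [coneFunctional]

theorem coneFunctional_zB (v r : ℕ) : coneFunctional v (zB v r) = 0 := by
  unfold zB
  split_ifs <;> simp [coneFunctional]

theorem coneFunctional_qB (v r : ℕ) : coneFunctional v (qB v r) = 0 := by
  unfold qB
  split_ifs <;> simp [coneFunctional]

/-- Let `k ≥ 1`, `v = 2k`, and let `V` be the F₂-vector space with basis
`{α, β, γ} ∪ {z_1, …, z_v} ∪ {Q_1, …, Q_v}`, with linear differential
`d α = β + γ`, `d β = d γ = Q_1`, `d z_r = Q_r` for odd `r`,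
`d z_r = z_{r-1} + z_{r+1} + Q_r` for even `r` (convention `z_{v+1} = 0`),
`d Q_r = 0` for odd `r`, and `d Q_r = Q_{r-1} + Q_{r+1}` for even `r`
(convention `Q_{v+1} = 0`). Then `d ∘ d = 0` and the homology `ker d / range d` is a
one-dimensional F₂-vector space spanned by the class of `γ + z_1`. -/
theorem cone_middle_summand_homology (k : ℕ) (hk : 1 ≤ k) (v : ℕ) (hv : v = 2 * k)
    (d : (ConeB v → ZMod 2) →ₗ[ZMod 2] (ConeB v → ZMod 2))
    (hal : d (Pi.single ConeB.al 1) = Pi.single ConeB.be 1 + Pi.single ConeB.ga 1)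
    (hbe : d (Pi.single ConeB.be 1) = qB v 1)
    (hga : d (Pi.single ConeB.ga 1) = qB v 1)
    (hzo : ∀ r : ℕ, 1 ≤ r → r ≤ v → Odd r → d (zB v r) = qB v r)
    (hze : ∀ r : ℕ, 1 ≤ r → r ≤ v → Even r →
      d (zB v r) = zB v (r - 1) + zB v (r + 1) + qB v r)
    (hqo : ∀ r : ℕ, 1 ≤ r → r ≤ v → Odd r → d (qB v r) = 0)
    (hqe : ∀ r : ℕ, 1 ≤ r → r ≤ v → Even r → d (qB v r) = qB v (r - 1) + qB v (r + 1)) :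
    d ∘ₗ d = 0 ∧
    (Pi.single ConeB.ga 1 + zB v 1) ∈ LinearMap.ker d ∧
    (Pi.single ConeB.ga 1 + zB v 1) ∉ LinearMap.range d ∧
    ∀ x ∈ LinearMap.ker d,
      x ∈ LinearMap.range d ∨
      x + (Pi.single ConeB.ga 1 + zB v 1) ∈ LinearMap.range d := by
  have two (x : ConeB v → ZMod 2) : x + x = 0 :=
    funext fun i => CharTwo.add_self_eq_zero (x i)
  have hzo' (r : ℕ) (hr : Odd r) : d (zB v r) = qB v r := by
    by_cases h : r ≤ v
    · exact hzo r hr.pos h hr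
    · rw [zB_of_not_le h, qB_of_not_le h, map_zero]
  have hqo' (r : ℕ) (hr : Odd r) : d (qB v r) = 0 := by
    by_cases h : r ≤ v
    · exact hqo r hr.pos h hr
    · rw [qB_of_not_le h, map_zero]
  have hpred (r : ℕ) (h1 : 1 ≤ r) (hr : Even r) : Odd (r - 1) := Nat.Even.sub_odd h1 hr odd_one
  have hdd : d ∘ₗ d = 0 := by
    refine coneB_linearMap_ext ?_ ?_ ?_ (fun r h1 h2 => ?_) (fun r h1 h2 => ?_)
    · simp [hal, hbe, hga, two]
    · simp [hbe, hqo' 1 odd_one]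
    · simp [hga, hqo' 1 odd_one]
    · rcases Nat.even_or_odd r with hr | hr
      · simp [hze r h1 h2 hr, hqe r h1 h2 hr, hzo' _ (hpred r h1 hr), hzo' _ hr.add_one, two]
      · simp [hzo' r hr, hqo' r hr]
    · rcases Nat.even_or_odd r with hr | hr
      · simp [hqe r h1 h2 hr, hqo' _ (hpred r h1 hr), hqo' _ hr.add_one]
      · simp [hqo' r hr]
  have hφ : coneFunctional v ∘ₗ d = 0 := by
    refine coneB_linearMap_ext ?_ ?_ ?_ (fun r h1 h2 => ?_) (fun r h1 h2 => ?_)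
    · simp [hal, coneFunctional_be, coneFunctional_ga, CharTwo.add_self_eq_zero]
    · simp [hbe, coneFunctional_qB]
    · simp [hga, coneFunctional_qB]
    · rcases Nat.even_or_odd r with hr | hr
      · simp [hze r h1 h2 hr, coneFunctional_zB, coneFunctional_qB]
      · simp [hzo' r hr, coneFunctional_qB]
    · rcases Nat.even_or_odd r with hr | hr
      · simp [hqe r h1 h2 hr, coneFunctional_qB]
      · simp [hqo' r hr]
  have hhom : d ∘ₗ coneHomotopy v + coneHomotopy v ∘ₗ d =
      LinearMap.id + (coneFunctional v).smulRight (Pi.single ConeB.ga 1 + zB v 1) := by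
    refine coneB_linearMap_ext ?_ ?_ ?_ (fun r h1 h2 => ?_) (fun r h1 h2 => ?_)
    · simp [hal, coneHomotopy_al, coneHomotopy_be, coneHomotopy_ga, coneFunctional_al]
    · simp [hal, hbe, coneHomotopy_be, coneHomotopy_qB, coneFunctional_be, add_assoc]
    · simp [hga, coneHomotopy_ga, coneHomotopy_qB, coneFunctional_ga, ← add_assoc, two]
    · rcases Nat.even_or_odd r with hr | hr
      · simp [hze r h1 h2 hr, coneHomotopy_zB, coneHomotopy_qB, coneFunctional_zB]
      · simp [hzo' r hr, coneHomotopy_zB, coneHomotopy_qB, coneFunctional_zB]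
    · rcases Nat.even_or_odd r with hr | hr
      · simp only [LinearMap.add_apply, LinearMap.comp_apply, coneHomotopy_qB, hze r h1 h2 hr,
          hqe r h1 h2 hr, map_add, LinearMap.id_apply, LinearMap.smulRight_apply,
          coneFunctional_qB, zero_smul, add_zero]
        rw [add_right_comm, two, zero_add]
      · simp [hqo' r hr, hzo' r hr, coneHomotopy_qB, coneFunctional_qB]
  refine ⟨hdd, ?_, ?_, fun x hx => ?_⟩
  · simp [hga, hzo' 1 odd_one, two]
  · rintro ⟨y, hy⟩
    have h := LinearMap.congr_fun hφ y
    simp [hy, coneFunctional_ga, coneFunctional_zB] at h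
  · have h := LinearMap.congr_fun hhom x
    simp only [LinearMap.add_apply, LinearMap.comp_apply, LinearMap.mem_ker.mp hx, map_zero,
      add_zero, LinearMap.id_apply, LinearMap.smulRight_apply] at h
    have hcases : ∀ a : ZMod 2, a = 0 ∨ a = 1 := by decide
    rcases hcases (coneFunctional v x) with h0 | h0
    · exact Or.inl ⟨_, h.trans (by simp [h0])⟩
    · exact Or.inr ⟨_, h.trans (by simp [h0])⟩
end

section
/- Let k ≥ 1, v = 2k, R = F_2[U, U^{-1}], and let M be the free R-module with basis {a, b, c, e, z_0} ∪ {z_r^s : 1 ≤ r ≤ v, s ∈ {1,2}}, with R-linear differential ∂ given by ∂a = b + c, ∂b = ∂c = U·e, ∂z_0 = z_1^1 + z_1^2, ∂z_r^s = z_{r-1}^s + z_{r+1}^s for even r with 0 < r < v, ∂z_v^s = z_{v-1}^s, and ∂ = 0 on e and on z_r^s for odd r. Define the R-linear map ι : M → M by ι(a) = a + z_0, ι(b) = c + z_1^2, ι(c) = b + z_1^1, ι(z_0) = z_0 + e, ι(e) = e, ι(z_r^1) = z_r^2 and ι(z_r^2) = z_r^1 for 1 ≤ r ≤ v. Then ι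 ∘ ∂ = ∂ ∘ ι, and ι ∘ ι = σ, where σ is the R-linear map with σ(a) = a + e and σ fixing all other basis elements. -/
/- On the model complex C₁ (negative staircase of length v = 2k plus one square on the
main diagonal), the involution ι is a chain map and squares to the Sarkar involution σ. -/

open LaurentPolynomial

/-- `R2` is the Laurent polynomial ring `F₂[U, U⁻¹]`. -/
abbrev R2 : Type := LaurentPolynomial (ZMod 2)

/-- The variable `U`. -/
noncomputable def U : R2 := T 1

/-- Basis `{a, b, c, e, z_0} ∪ {z_r^s : 1 ≤ r ≤ v, s ∈ {1,2}}` of the model complex `C₁`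
(with `z s r` for `s : Fin 2`, `r : Fin v` standing for `z_{r+1}^{s+1}`). -/
inductive ModelB (v : ℕ) : Type
  | a | b | c | e | z0 | z (s : Fin 2) (r : Fin v)
  deriving DecidableEq

/-- The basis vector `z_r^{s+1}` for `1 ≤ r ≤ v`, extended by `0` outside that range. -/
noncomputable def zS (v : ℕ) (s : Fin 2) (r : ℕ) : ModelB v → R2 :=
  if h : 1 ≤ r ∧ r ≤ v then Pi.single (ModelB.z s ⟨r - 1, by omega⟩) 1 else 0

instance ModelB.instFinite (v : ℕ) : Finite (ModelB v) :=
  Finite.of_surjective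
    (Sum.elim ![ModelB.a, ModelB.b, ModelB.c, ModelB.e, ModelB.z0]
      fun p : Fin 2 × Fin v => ModelB.z p.1 p.2) <| by
    rintro (_ | _ | _ | _ | _ | ⟨s, r⟩)
    exacts [⟨.inl 0, rfl⟩, ⟨.inl 1, rfl⟩, ⟨.inl 2, rfl⟩, ⟨.inl 3, rfl⟩, ⟨.inl 4, rfl⟩,
      ⟨.inr (s, r), rfl⟩]

/-- Linear maps out of the model complex that agree on its basis are equal. -/
theorem ModelB.linearMap_ext {v : ℕ} {f g : (ModelB v → R2) →ₗ[R2] (ModelB v → R2)}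
    (ha : f (Pi.single ModelB.a 1) = g (Pi.single ModelB.a 1))
    (hb : f (Pi.single ModelB.b 1) = g (Pi.single ModelB.b 1))
    (hc : f (Pi.single ModelB.c 1) = g (Pi.single ModelB.c 1))
    (he : f (Pi.single ModelB.e 1) = g (Pi.single ModelB.e 1))
    (hz0 : f (Pi.single ModelB.z0 1) = g (Pi.single ModelB.z0 1))
    (hz : ∀ s r, 1 ≤ r → r ≤ v → f (zS v s r) = g (zS v s r)) : f = g := by
  refine LinearMap.pi_ext' fun i => LinearMap.ext_ring ?_
  rcases i with _ | _ | _ | _ | _ | ⟨s, r⟩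
  · exact ha
  · exact hb
  · exact hc
  · exact he
  · exact hz0
  · have h := hz s (r + 1) (by omega) (by omega)
    have hr : 1 ≤ (r : ℕ) + 1 ∧ (r : ℕ) + 1 ≤ v := by omega
    rw [zS, dif_pos hr] at h
    exact h

theorem ModelB.add_self_eq_zero {v : ℕ} (x : ModelB v → R2) : x + x = 0 := by
  have h : (2 : R2) = 0 := by
    have := congrArg (LaurentPolynomial.C (R := ZMod 2)) (show (2 : ZMod 2) = 0 from rfl)
    simpa only [map_ofNat, map_zero] using this
  rw [← two_smul R2 x, h, zero_smul]

/-- On the model complex `C₁` (free `R2`-module on `{a,b,c,e,z_0} ∪ {z_r^s}` with the stated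
differential `∂`), the map `ι` with `ι a = a + z_0`, `ι b = c + z_1^2`, `ι c = b + z_1^1`,
`ι z_0 = z_0 + e`, `ι e = e`, `ι z_r^1 = z_r^2`, `ι z_r^2 = z_r^1` satisfies
`ι ∘ ∂ = ∂ ∘ ι` and `ι ∘ ι = σ`, where `σ` is the Sarkar involution sending `a` to `a + e`
and fixing all other basis elements. -/
theorem modelC1_involution (k : ℕ) (hk : 1 ≤ k) (v : ℕ) (hv : v = 2 * k)
    (d ι σ : (ModelB v → R2) →ₗ[R2] (ModelB v → R2))
    -- the differential ∂ = d
    (hda : d (Pi.single ModelB.a 1) = Pi.single ModelB.b 1 + Pi.single ModelB.c 1)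
    (hdb : d (Pi.single ModelB.b 1) = U • (Pi.single ModelB.e 1 : ModelB v → R2))
    (hdc : d (Pi.single ModelB.c 1) = U • (Pi.single ModelB.e 1 : ModelB v → R2))
    (hdz0 : d (Pi.single ModelB.z0 1) = zS v 0 1 + zS v 1 1)
    (hdzeven : ∀ s : Fin 2, ∀ r : ℕ, 0 < r → r < v → Even r →
      d (zS v s r) = zS v s (r - 1) + zS v s (r + 1))
    (hdzv : ∀ s : Fin 2, d (zS v s v) = zS v s (v - 1))
    (hde : d (Pi.single ModelB.e 1) = 0)
    (hdzodd : ∀ s : Fin 2, ∀ r : ℕ, 1 ≤ r → r ≤ v → Odd r → d (zS v s r) = 0)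
    -- the involution ι
    (hia : ι (Pi.single ModelB.a 1) = Pi.single ModelB.a 1 + Pi.single ModelB.z0 1)
    (hib : ι (Pi.single ModelB.b 1) = Pi.single ModelB.c 1 + zS v 1 1)
    (hic : ι (Pi.single ModelB.c 1) = Pi.single ModelB.b 1 + zS v 0 1)
    (hiz0 : ι (Pi.single ModelB.z0 1) = Pi.single ModelB.z0 1 + Pi.single ModelB.e 1)
    (hie : ι (Pi.single ModelB.e 1) = Pi.single ModelB.e 1)
    (hiz : ∀ r : ℕ, 1 ≤ r → r ≤ v → ι (zS v 0 r) = zS v 1 r ∧ ι (zS v 1 r) = zS v 0 r)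
    -- the Sarkar involution σ
    (hsa : σ (Pi.single ModelB.a 1) = Pi.single ModelB.a 1 + Pi.single ModelB.e 1)
    (hsb : σ (Pi.single ModelB.b 1) = Pi.single ModelB.b 1)
    (hsc : σ (Pi.single ModelB.c 1) = Pi.single ModelB.c 1)
    (hse : σ (Pi.single ModelB.e 1) = Pi.single ModelB.e 1)
    (hsz0 : σ (Pi.single ModelB.z0 1) = Pi.single ModelB.z0 1)
    (hsz : ∀ s : Fin 2, ∀ r : ℕ, 1 ≤ r → r ≤ v → σ (zS v s r) = zS v s r) :
    ι ∘ₗ d = d ∘ₗ ι ∧ ι ∘ₗ ι = σ := by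
  have swap : ∀ s r, 1 ≤ r → r ≤ v → ι (zS v s r) = zS v (1 - s) r := by
    intro s r h₁ h₂
    fin_cases s
    exacts [(hiz r h₁ h₂).1, (hiz r h₁ h₂).2]
  have hv₁ : 1 ≤ v := by omega
  have hi₀ := (hiz 1 le_rfl hv₁).1
  have hi₁ := (hiz 1 le_rfl hv₁).2
  have hd₁ := fun s => hdzodd s 1 le_rfl hv₁ odd_one
  constructor
  · apply ModelB.linearMap_ext <;> simp only [LinearMap.comp_apply]
    · rw [hda, hia, map_add, map_add, hib, hic, hda, hdz0]
      abel
    · rw [hdb, hib, map_smul, map_add, hie, hdc, hd₁, add_zero]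
    · rw [hdc, hic, map_smul, map_add, hie, hdb, hd₁, add_zero]
    · rw [hde, hie, hde, map_zero]
    · rw [hdz0, hiz0, map_add, map_add, hi₀, hi₁, hdz0, hde, add_zero, add_comm]
    · intro s r h₁ h₂
      rw [swap s r h₁ h₂]
      rcases Nat.even_or_odd r with hr | hr
      · have hr₂ : 2 ≤ r := by obtain ⟨m, rfl⟩ := hr; omega
        rcases h₂.lt_or_eq with hlt | rfl
        · rw [hdzeven s r h₁ hlt hr, hdzeven _ r h₁ hlt hr, map_add,
            swap s (r - 1) (by omega) (by omega), swap s (r + 1) (by omega) (by omega)]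
        · rw [hdzv, hdzv, swap s (r - 1) (by omega) (by omega)]
      · rw [hdzodd s r h₁ h₂ hr, hdzodd _ r h₁ h₂ hr, map_zero]
  · apply ModelB.linearMap_ext <;> simp only [LinearMap.comp_apply]
    · rw [hia, map_add, hia, hiz0, hsa, add_assoc, ← add_assoc (Pi.single ModelB.z0 1),
        ModelB.add_self_eq_zero, zero_add]
    · rw [hib, map_add, hic, hi₁, hsb, add_assoc, ModelB.add_self_eq_zero, add_zero]
    · rw [hic, map_add, hib, hi₀, hsc, add_assoc, ModelB.add_self_eq_zero, add_zero]
    · rw [hie, hie, hse]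
    · rw [hiz0, map_add, hiz0, hie, hsz0, add_assoc, ModelB.add_self_eq_zero, add_zero]
    · intro s r h₁ h₂
      rw [swap s r h₁ h₂, swap _ r h₁ h₂, hsz s r h₁ h₂, sub_sub_cancel]
end

section
/- Let k ≥ 1, v = 2k, R = F_2[U, U^{-1}], and let (M, ∂, ι) be the model complex C_1 with its involution: M is the free R-module with basis {a, b, c, e, z_0} ∪ {z_r^s : 1 ≤ r ≤ v, s ∈ {1,2}}; ∂a = b + c, ∂b = ∂c = U·e, ∂z_0 = z_1^1 + z_1^2, ∂z_r^s = z_{r-1}^s + z_{r+1}^s for even r with 0 < r < v, ∂z_v^s = z_{v-1}^s, ∂ = 0 otherwise; and ι(a) = a + z_0, ι(b) = c + z_1^2, ι(c) = b + z_1^1, ι(z_0) = z_0 + e, ι(e) = e, ι(z_r^1) = z_r^2, ι(z_r^2) = z_r^1. Let N = M ⊕ M with R-linear differential D(x, y) = (∂x, (1 + ι)(x) + ∂y). Then D ∘ D = 0 and the homology ker(D)/range(D) is a free R-module of rank two. -/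
/- The mapping cone of (1 + ι) on the model complex C₁ has homology a free R-module of
rank two. -/

open LaurentPolynomial

/-- In a module over a ring of characteristic two every element is its own negative. -/
theorem add_self_eq_zero_of_charTwo_module (R : Type*) {M : Type*} [CommRing R] [CharP R 2]
    [AddCommGroup M] [Module R M] (x : M) : x + x = 0 := by
  rw [← two_smul R x, CharTwo.two_eq_zero, zero_smul]

/-- In characteristic two, suppose `H(M, d)` is free on the class of a cycle `Z`, detected by `φ`,
and a chain map `f` sends `Z` to the boundary `d β`. Then the homology of the mapping cone of
`f` is free on the classes of `(Z, β)` and `(0, Z)`. -/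
theorem cone_homology_of_free_rank_one {R M : Type*} [CommRing R] [CharP R 2]
    [AddCommGroup M] [Module R M] (d f : M →ₗ[R] M) (φ : M →ₗ[R] R) (Z β : M)
    (hdd : ∀ x, d (d x) = 0) (hf : ∀ x, f (d x) = d (f x)) (hφd : ∀ x, φ (d x) = 0)
    (hφZ : φ Z = 1) (hdZ : d Z = 0) (hker : ∀ x, d x = 0 → ∃ p, x = φ x • Z + d p)
    (hfZ : f Z = d β) (D : (M × M) →ₗ[R] (M × M)) (hD : ∀ x y, D (x, y) = (d x, f x + d y)) :
    D ∘ₗ D = 0 ∧ ∃ u w : M × M, u ∈ LinearMap.ker D ∧ w ∈ LinearMap.ker D ∧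
      (∀ x ∈ LinearMap.ker D, ∃ c₁ c₂ : R, x + c₁ • u + c₂ • w ∈ LinearMap.range D) ∧
      (∀ c₁ c₂ : R, c₁ • u + c₂ • w ∈ LinearMap.range D → c₁ = 0 ∧ c₂ = 0) := by
  have add_self : ∀ x : M, x + x = 0 := add_self_eq_zero_of_charTwo_module R
  refine ⟨?_, (Z, β), (0, Z), ?_, ?_, ?_, ?_⟩
  · refine LinearMap.ext fun ⟨x, y⟩ => ?_
    simp [hD, hdd, hf, add_self]
  · simp [hD, hdZ, hfZ, add_self]
  · simp [hD, hdZ]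
  · rintro ⟨x, y⟩ hxy
    obtain ⟨hx, hy⟩ : d x = 0 ∧ f x + d y = 0 := by simpa [hD] using hxy
    obtain ⟨p, hp⟩ := hker x hx
    have hcycle : d (φ x • β + f p + y) = 0 := by
      rw [hp] at hy
      simpa [hfZ, hf] using hy
    obtain ⟨q, hq⟩ := hker _ hcycle
    refine ⟨φ x, φ (φ x • β + f p + y), (p, q), ?_⟩
    generalize φ (φ x • β + f p + y) = c at hq ⊢
    rw [hD]
    refine Prod.ext ?_ ?_
    · have h := add_self (φ x • Z)
      simp only [Prod.fst_add, Prod.smul_fst, smul_zero, add_zero]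
      linear_combination (norm := module) -h - hp
    · have h := add_self (c • Z)
      have h' := add_self (f p)
      simp only [Prod.snd_add, Prod.smul_snd]
      linear_combination (norm := module) h' - h - hq
  · rintro c₁ c₂ ⟨⟨x, y⟩, hxy⟩
    rw [hD] at hxy
    have h₁ : d x = c₁ • Z := by simpa using congrArg Prod.fst hxy
    have h₂ : f x + d y = c₁ • β + c₂ • Z := by simpa using congrArg Prod.snd hxy
    have hc₁ : c₁ = 0 := by simpa [hφd, hφZ, eq_comm] using congrArg φ h₁
    subst hc₁
    obtain ⟨p, hp⟩ := hker x (by simpa using h₁)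
    refine ⟨rfl, ?_⟩
    rw [hp] at h₂
    simpa [hφd, hφZ, hfZ, hf, eq_comm] using congrArg φ h₂

namespace ModelB

instance finite (v : ℕ) : Finite (ModelB v) := by
  let g : Fin 5 ⊕ (Fin 2 × Fin v) → ModelB v :=
    Sum.elim ![a, b, c, e, z0] fun p => z p.1 p.2
  refine Finite.of_surjective g ?_
  rintro (_ | _ | _ | _ | _ | ⟨s, r⟩)
  exacts [⟨.inl 0, rfl⟩, ⟨.inl 1, rfl⟩, ⟨.inl 2, rfl⟩, ⟨.inl 3, rfl⟩, ⟨.inl 4, rfl⟩,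
    ⟨.inr (s, r), rfl⟩]

end ModelB

theorem zS_of_lt {v : ℕ} (s : Fin 2) {r : ℕ} (h : v < r) : zS v s r = 0 :=
  dif_neg (by omega)

theorem zS_succ {v : ℕ} (s : Fin 2) (r : Fin v) :
    zS v s (r + 1) = Pi.single (ModelB.z s r) 1 :=
  dif_pos ⟨by omega, by omega⟩

theorem zS_apply_z0 (v : ℕ) (s : Fin 2) (r : ℕ) : zS v s r ModelB.z0 = 0 := by
  unfold zS
  split_ifs <;> simp

/-- Linear maps on the model complex agree once they agree on the generators. -/
theorem modelB_linearMap_ext {k : ℕ} {N : Type*} [AddCommMonoid N] [Module R2 N]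
    {f g : (ModelB (2 * k) → R2) →ₗ[R2] N}
    (ha : f (Pi.single ModelB.a 1) = g (Pi.single ModelB.a 1))
    (hb : f (Pi.single ModelB.b 1) = g (Pi.single ModelB.b 1))
    (hc : f (Pi.single ModelB.c 1) = g (Pi.single ModelB.c 1))
    (he : f (Pi.single ModelB.e 1) = g (Pi.single ModelB.e 1))
    (hz0 : f (Pi.single ModelB.z0 1) = g (Pi.single ModelB.z0 1))
    (hodd : ∀ s, ∀ i < k, f (zS (2 * k) s (2 * i + 1)) = g (zS (2 * k) s (2 * i + 1)))
    (heven : ∀ s, ∀ i < k, f (zS (2 * k) s (2 * i + 2)) = g (zS (2 * k) s (2 * i + 2))) :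
    f = g := by
  refine LinearMap.pi_ext' fun t => LinearMap.ext_ring ?_
  change f (Pi.single t 1) = g (Pi.single t 1)
  rcases t with _ | _ | _ | _ | _ | ⟨s, r⟩
  · exact ha
  · exact hb
  · exact hc
  · exact he
  · exact hz0
  · rw [← zS_succ]
    rcases Nat.even_or_odd' (r : ℕ) with ⟨i, hi | hi⟩
    · rw [hi]
      exact hodd s i (by omega)
    · rw [hi]
      exact heven s i (by omega)

/-- The sum of the generators `z_j^{s+1}` over the even `j` with `2 i < j ≤ 2 k`. -/
noncomputable def evenTail (k : ℕ) (s : Fin 2) (i : ℕ) : ModelB (2 * k) → R2 :=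
  ∑ j ∈ Finset.Ico i k, zS (2 * k) s (2 * j + 2)

theorem evenTail_self (k : ℕ) (s : Fin 2) : evenTail k s k = 0 := by
  simp [evenTail]

theorem evenTail_eq_add {k i : ℕ} (s : Fin 2) (hi : i < k) :
    evenTail k s i = zS (2 * k) s (2 * i + 2) + evenTail k s (i + 1) :=
  Finset.sum_eq_sum_Ico_succ_bot hi _

theorem evenTail_apply_z0 (k : ℕ) (s : Fin 2) (i : ℕ) : evenTail k s i ModelB.z0 = 0 := by
  simp [evenTail, Finset.sum_apply, zS_apply_z0]

/-- The values on the generators of the contracting homotopy of the model complex onto its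
homology. -/
noncomputable def homotopyValue (k : ℕ) : ModelB (2 * k) → ModelB (2 * k) → R2
  | .b => Pi.single ModelB.a 1
  | .e => (T (-1) : R2) • Pi.single ModelB.c 1
  | .z s r => if Even (r : ℕ) then evenTail k s (r / 2) else 0
  | _ => 0

/-- There is a linear map taking prescribed values on the generators. -/
theorem exists_linearMap_single {α N : Type*} [Finite α] [DecidableEq α] [AddCommMonoid N]
    [Module R2 N] (F : α → N) : ∃ h : (α → R2) →ₗ[R2] N, ∀ t, h (Pi.single t 1) = F t := by
  have := Fintype.ofFinite α
  refine ⟨(Pi.basisFun R2 α).constr R2 F, fun t => ?_⟩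
  have h := (Pi.basisFun R2 α).constr_basis R2 F t
  rw [Pi.basisFun_apply] at h
  convert h

/-- Let `(M, ∂, ι)` be the model complex `C₁` with its involution (`v = 2k`, `k ≥ 1`), and
let `N = M ⊕ M` with differential `D (x, y) = (∂ x, (1 + ι) x + ∂ y)`. Then `D ∘ D = 0` and
the homology `ker D / range D` is a free `R2`-module of rank two. -/
theorem modelC1_cone_homology (k : ℕ) (hk : 1 ≤ k) (v : ℕ) (hv : v = 2 * k)
    (d ι : (ModelB v → R2) →ₗ[R2] (ModelB v → R2))
    -- the differential ∂ = d
    (hda : d (Pi.single ModelB.a 1) = Pi.single ModelB.b 1 + Pi.single ModelB.c 1)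
    (hdb : d (Pi.single ModelB.b 1) = U • (Pi.single ModelB.e 1 : ModelB v → R2))
    (hdc : d (Pi.single ModelB.c 1) = U • (Pi.single ModelB.e 1 : ModelB v → R2))
    (hdz0 : d (Pi.single ModelB.z0 1) = zS v 0 1 + zS v 1 1)
    (hdzeven : ∀ s : Fin 2, ∀ r : ℕ, 0 < r → r < v → Even r →
      d (zS v s r) = zS v s (r - 1) + zS v s (r + 1))
    (hdzv : ∀ s : Fin 2, d (zS v s v) = zS v s (v - 1))
    (hde : d (Pi.single ModelB.e 1) = 0)
    (hdzodd : ∀ s : Fin 2, ∀ r : ℕ, 1 ≤ r → r ≤ v → Odd r → d (zS v s r) = 0)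
    -- the involution ι
    (hia : ι (Pi.single ModelB.a 1) = Pi.single ModelB.a 1 + Pi.single ModelB.z0 1)
    (hib : ι (Pi.single ModelB.b 1) = Pi.single ModelB.c 1 + zS v 1 1)
    (hic : ι (Pi.single ModelB.c 1) = Pi.single ModelB.b 1 + zS v 0 1)
    (hiz0 : ι (Pi.single ModelB.z0 1) = Pi.single ModelB.z0 1 + Pi.single ModelB.e 1)
    (hie : ι (Pi.single ModelB.e 1) = Pi.single ModelB.e 1)
    (hiz : ∀ r : ℕ, 1 ≤ r → r ≤ v → ι (zS v 0 r) = zS v 1 r ∧ ι (zS v 1 r) = zS v 0 r)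
    -- the mapping cone differential D on N = M ⊕ M
    (D : ((ModelB v → R2) × (ModelB v → R2)) →ₗ[R2] ((ModelB v → R2) × (ModelB v → R2)))
    (hD : ∀ x y : ModelB v → R2, D (x, y) = (d x, x + ι x + d y)) :
    D ∘ₗ D = 0 ∧
    ∃ u w : (ModelB v → R2) × (ModelB v → R2),
      u ∈ LinearMap.ker D ∧ w ∈ LinearMap.ker D ∧
      (∀ x ∈ LinearMap.ker D, ∃ c₁ c₂ : R2, x + c₁ • u + c₂ • w ∈ LinearMap.range D) ∧
      (∀ c₁ c₂ : R2, c₁ • u + c₂ • w ∈ LinearMap.range D → c₁ = 0 ∧ c₂ = 0) := by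
  subst hv
  have : CharP R2 2 :=
    charP_of_injective_ringHom (C : ZMod 2 →+* R2).injective 2
  have add_self : ∀ x : ModelB (2 * k) → R2, x + x = 0 := add_self_eq_zero_of_charTwo_module R2
  have hUT : (T (-1) : R2) * U = 1 := by
    rw [U, ← T_add]
    simp
  have hTU : U * (T (-1) : R2) = 1 := by rw [mul_comm, hUT]
  have hd_odd : ∀ s, ∀ i ≤ k, d (zS (2 * k) s (2 * i + 1)) = 0 := by
    intro s i hi
    rcases hi.lt_or_eq with hi | rfl
    · exact hdzodd s _ (by omega) (by omega) ⟨i, rfl⟩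
    · rw [zS_of_lt s (by omega), map_zero]
  have hd_even : ∀ s, ∀ i < k, d (zS (2 * k) s (2 * i + 2)) =
      zS (2 * k) s (2 * i + 1) + zS (2 * k) s (2 * (i + 1) + 1) := by
    intro s i hi
    rcases (Nat.succ_le_of_lt hi).lt_or_eq with hi' | rfl
    · exact hdzeven s (2 * i + 2) (by omega) (by omega) ⟨i + 1, by omega⟩
    · rw [zS_of_lt s (show 2 * (i + 1) < 2 * (i + 1) + 1 by omega), add_zero]
      exact hdzv s
  have hd_tail : ∀ s, ∀ i ≤ k, d (evenTail k s i) = zS (2 * k) s (2 * i + 1) := by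
    intro s i hi
    induction hi using Nat.decreasingInduction with
    | self => rw [evenTail_self, map_zero, zS_of_lt s (by omega)]
    | of_succ i hi ih =>
      rw [evenTail_eq_add s hi, map_add, ih, hd_even s i hi, add_assoc, add_self, add_zero]
  have hi_zero : ∀ r, 1 ≤ r → ι (zS (2 * k) 0 r) = zS (2 * k) 1 r := by
    intro r hr
    by_cases h : r ≤ 2 * k
    · exact (hiz r hr h).1
    · rw [zS_of_lt 0 (by omega), zS_of_lt 1 (by omega), map_zero]
  have hi_one : ∀ r, 1 ≤ r → ι (zS (2 * k) 1 r) = zS (2 * k) 0 r := by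
    intro r hr
    by_cases h : r ≤ 2 * k
    · exact (hiz r hr h).2
    · rw [zS_of_lt 0 (by omega), zS_of_lt 1 (by omega), map_zero]
  have hdd : d ∘ₗ d = 0 := by
    apply modelB_linearMap_ext
    · simp [hda, hdb, hdc, add_self]
    · simp [hdb, hde]
    · simp [hdc, hde]
    · simp [hde]
    · have h₀ := hd_odd 0 0 (by omega)
      have h₁ := hd_odd 1 0 (by omega)
      simp_all
    · intro s i hi
      simp [hd_odd s i hi.le]
    · intro s i hi
      simp [hd_even s i hi, hd_odd s i hi.le, hd_odd s (i + 1) hi]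
  have hchain : ι ∘ₗ d = d ∘ₗ ι := by
    have h₀ := hd_odd 0 0 (by omega)
    have h₁ := hd_odd 1 0 (by omega)
    simp only [mul_zero, zero_add] at h₀ h₁
    apply modelB_linearMap_ext
    · simp only [LinearMap.comp_apply, hda, hia, map_add, hib, hic, hdz0]
      abel
    · simp [hdb, hib, hie, hdc, h₁]
    · simp [hdb, hic, hie, hdc, h₀]
    · simp [hde, hie]
    · simp [hdz0, hiz0, hde, hi_zero, hi_one, add_comm]
    · intro s i hi
      fin_cases s <;> simp [hi_zero, hi_one, hd_odd _ i hi.le]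
    · intro s i hi
      fin_cases s <;> simp [hi_zero, hi_one, hd_even _ i hi]
  have hφd : (LinearMap.proj ModelB.z0 : _ →ₗ[R2] R2) ∘ₗ d = 0 := by
    apply modelB_linearMap_ext
    · simp [hda]
    · simp [hdb]
    · simp [hdc]
    · simp [hde]
    · simp [hdz0, zS_apply_z0]
    · intro s i hi
      simp [hd_odd s i hi.le]
    · intro s i hi
      simp [hd_even s i hi, zS_apply_z0]
  obtain ⟨h, hh⟩ := exists_linearMap_single (homotopyValue k)
  have hh_odd : ∀ s, ∀ i ≤ k, h (zS (2 * k) s (2 * i + 1)) = evenTail k s i := by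
    intro s i hi
    rcases hi.lt_or_eq with hi | rfl
    · rw [zS_succ s ⟨2 * i, by omega⟩, hh]
      simp [homotopyValue]
    · rw [zS_of_lt s (by omega), map_zero, evenTail_self]
  have hh_even : ∀ s, ∀ i < k, h (zS (2 * k) s (2 * i + 2)) = 0 := by
    intro s i hi
    rw [zS_succ s ⟨2 * i + 1, by omega⟩, hh]
    simp [homotopyValue]
  set Z : ModelB (2 * k) → R2 :=
    Pi.single ModelB.z0 1 + (evenTail k 0 0 + evenTail k 1 0) with hZ
  have hhomotopy : d ∘ₗ h + h ∘ₗ d + (LinearMap.proj ModelB.z0 : _ →ₗ[R2] R2).smulRight Z =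
      LinearMap.id := by
    apply modelB_linearMap_ext
    · simp [hda, hh, homotopyValue]
    · simp [hda, hdb, hh, homotopyValue, smul_smul, hTU, add_assoc, add_self]
    · simp [hdc, hh, homotopyValue, smul_smul, hTU]
    · simp [hdc, hde, hh, homotopyValue, smul_smul, hUT]
    · have h₀ := hh_odd 0 0 (by omega)
      have h₁ := hh_odd 1 0 (by omega)
      simp only [mul_zero, zero_add] at h₀ h₁
      have := add_self (evenTail k 0 0 + evenTail k 1 0)
      simp only [LinearMap.add_apply, LinearMap.comp_apply, hh, hdz0, map_add, h₀, h₁,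
        homotopyValue, LinearMap.smulRight_apply, LinearMap.proj_apply, Pi.single_eq_same, one_smul,
        map_zero,
        LinearMap.id_apply, hZ]
      linear_combination (norm := module) this
    · intro s i hi
      simp [hh_odd s i hi.le, hd_odd s i hi.le, hd_tail s i hi.le, zS_apply_z0]
    · intro s i hi
      simp [hh_even s i hi, hd_even s i hi, hh_odd s i hi.le, hh_odd s (i + 1) hi, zS_apply_z0,
        evenTail_eq_add s hi, add_assoc, add_self]
  have hi_tail : ι (evenTail k 0 0) = evenTail k 1 0 ∧ ι (evenTail k 1 0) = evenTail k 0 0 := by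
    constructor <;> simp [evenTail, hi_zero, hi_one]
  refine cone_homology_of_free_rank_one d (LinearMap.id + ι) (LinearMap.proj ModelB.z0) Z
    ((T (-1) : R2) • Pi.single ModelB.b 1) (LinearMap.congr_fun hdd) ?_
    (LinearMap.congr_fun hφd) ?_ ?_ ?_ ?_ D (by simpa using hD)
  · intro x
    simpa using LinearMap.congr_fun hchain x
  · simp [hZ, evenTail_apply_z0]
  · simp [hZ, hdz0, hd_tail, add_self]
  · intro x hx
    refine ⟨h x, ?_⟩
    have := LinearMap.congr_fun hhomotopy x
    simp only [LinearMap.add_apply, LinearMap.comp_apply, hx, map_zero, add_zero,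
      LinearMap.smulRight_apply, LinearMap.id_apply] at this
    rw [add_comm, this]
  · have h₁ := add_self (Pi.single ModelB.z0 1 + (evenTail k 0 0 + evenTail k 1 0))
    simp only [hZ, map_add, map_smul, LinearMap.add_apply, LinearMap.id_apply, hiz0, hi_tail.1,
      hi_tail.2, hdb, smul_smul, hUT, one_smul]
    linear_combination (norm := module) h₁
end

section
/- Let k ≥ 1, v = 2k, R = F_2[U, U^{-1}], and let (M, ∂, ι) be the dual model complex C̄_1 with its involution: M is the free R-module with basis {a, b, c, e, z_0} ∪ {z_r^s : 1 ≤ r ≤ v, s ∈ {1,2}}; ∂a = b + c, ∂b = ∂c = U·e, ∂z_1^s = z_0 + z_2^s, ∂z_r^s = z_{r-1}^s + z_{r+1}^s for odd r with 1 < r ≤ v-1, ∂ = 0 otherwise; and ι(a) = a + z_0, ι(b) = c, ι(c) = b, ι(e) = e, ι(z_0) = z_0 + e, ι(z_1^1) = z_1^2 + U^{-1}·c, ι(z_1^2) = z_1^1 + U^{-1}·b, ι(z_r^1) = z_r^2 and ι(z_r^2) = z_r^1 for 2 ≤ r ≤ v. Let N = M ⊕ M with R-linear differential D(x, y) = (∂x,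 (1 + ι)(x) + ∂y). Then D ∘ D = 0 and the homology ker(D)/range(D) is a free R-module of rank two. -/
/- The mapping cone of (1 + ι) on the dual model complex C̄₁ has homology a free R-module
of rank two. -/

open LaurentPolynomial

/-- Its inverse `U⁻¹`. -/
noncomputable def Uinv : R2 := T (-1)

/-- Homology of the mapping cone of `1 + ι`, for a complex `(M, d)` over a ring of characteristic
two that contracts by a homotopy `h` onto the line spanned by the cycle `z`. -/
theorem cone_homology_of_homotopy {R M : Type*} [CommRing R] [AddCommGroup M] [Module R M]
    (h2 : ∀ x : M, x + x = 0) (d ι h : M →ₗ[R] M) (φ β : M →ₗ[R] R) (z y₀ : M)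
    (hdd : ∀ x, d (d x) = 0) (hdι : ∀ x, d (ι x) = ι (d x))
    (hh : ∀ x, x + (d (h x) + h (d x)) = φ x • z) (hφd : ∀ x, φ (d x) = 0) (hφz : φ z = 1)
    (hdz : d z = 0) (hφι : ∀ x, φ (x + ι x) = β (d x)) (hy₀ : z + ι z + d y₀ = 0)
    (D : (M × M) →ₗ[R] (M × M)) (hD : ∀ x y : M, D (x, y) = (d x, x + ι x + d y)) :
    D ∘ₗ D = 0 ∧
    ∃ u w : M × M, u ∈ LinearMap.ker D ∧ w ∈ LinearMap.ker D ∧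
      (∀ x ∈ LinearMap.ker D, ∃ c₁ c₂ : R, x + c₁ • u + c₂ • w ∈ LinearMap.range D) ∧
      (∀ c₁ c₂ : R, c₁ • u + c₂ • w ∈ LinearMap.range D → c₁ = 0 ∧ c₂ = 0) := by
  have hDD : ∀ p, D (D p) = 0 := by
    rintro ⟨x, y⟩
    rw [hD, hD]
    simp only [map_add, hdd, hdι, add_zero, Prod.mk_eq_zero, true_and]
    exact h2 _
  -- a cycle is homologous to a multiple of `z`
  have hcyc : ∀ x, d x = 0 → x + φ x • z = d (h x) := by
    intro x hx
    rw [← hh, hx, map_zero, add_zero, ← add_assoc, h2, zero_add]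
  have hker : ∀ x y, (x, y) ∈ LinearMap.ker D ↔ d x = 0 ∧ x + ι x + d y = 0 := by
    intro x y
    rw [LinearMap.mem_ker, hD, Prod.mk_eq_zero]
  have hu : ((0, z) : M × M) ∈ LinearMap.ker D := by simp [hker, hdz]
  have hw : ((z, y₀) : M × M) ∈ LinearMap.ker D := (hker _ _).2 ⟨hdz, hy₀⟩
  refine ⟨LinearMap.ext hDD, (0, z), (z, y₀), hu, hw, ?_, ?_⟩
  · rintro ⟨x, y⟩ hxy
    have hx : d x = 0 := ((hker x y).1 hxy).1
    set q : M := y + φ x • y₀ + (h x + ι (h x)) with hq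
    have hsum : (x, y) + φ x • ((z, y₀) : M × M) + D (h x, 0) = (0, q) := by
      rw [hD, ← hcyc x hx]
      ext
      · simpa using h2 _
      · simp [hq]
    have hmem : ((0, q) : M × M) ∈ LinearMap.ker D := by
      rw [← hsum]
      exact add_mem (add_mem hxy (Submodule.smul_mem _ _ hw)) (hDD _)
    have hdq : d q = 0 := by simpa using ((hker 0 q).1 hmem).2
    refine ⟨φ q, φ x, (h x, h q), ?_⟩
    rw [hD, ← hcyc x hx, ← hcyc q hdq]
    ext
    · simp
    · simp only [Prod.snd_add, Prod.smul_snd]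
      have := h2 (h x + ι (h x))
      calc h x + ι (h x) + (q + φ q • z)
          = (h x + ι (h x)) + (h x + ι (h x)) + (y + φ q • z + φ x • y₀) := by
            nth_rewrite 1 [hq]; abel
        _ = _ := by rw [this, zero_add]
  · rintro c₁ c₂ ⟨⟨x, y⟩, hxy⟩
    rw [hD] at hxy
    have h₁ : d x = c₂ • z := by simpa using congrArg Prod.fst hxy
    have h₂ : x + ι x + d y = c₁ • z + c₂ • y₀ := by simpa using congrArg Prod.snd hxy
    have hc₂ : c₂ = 0 := by simpa [hφd, hφz] using (congrArg φ h₁).symm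
    subst hc₂
    rw [zero_smul] at h₁
    have := congrArg φ h₂
    rw [map_add, hφι, h₁, hφd] at this
    exact ⟨by simpa [hφz] using this.symm, rfl⟩

namespace ModelB

instance instFinite_s12 (v : ℕ) : Finite (ModelB v) := by
  refine Finite.of_surjective
    (Sum.elim ![a, b, c, e, z0] (fun p : Fin 2 × Fin v => z p.1 p.2)) ?_
  rintro (_ | _ | _ | _ | _ | ⟨s, r⟩)
  · exact ⟨.inl 0, rfl⟩
  · exact ⟨.inl 1, rfl⟩
  · exact ⟨.inl 2, rfl⟩
  · exact ⟨.inl 3, rfl⟩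
  · exact ⟨.inl 4, rfl⟩
  · exact ⟨.inr (s, r), rfl⟩

theorem zS_succ {v : ℕ} (s : Fin 2) (r : Fin v) : zS v s (r + 1) = Pi.single (z s r) 1 := by
  have : 1 ≤ (r : ℕ) + 1 ∧ (r : ℕ) + 1 ≤ v := by omega
  simp [zS, this]

/-- Linear maps out of the model agree once they agree on the generators, the `z_r^s` being
listed by the parity of `r`. -/
theorem linearMap_ext_s12 {k : ℕ} {P : Type*} [AddCommGroup P] [Module R2 P]
    {f g : (ModelB (2 * k) → R2) →ₗ[R2] P}
    (ha : f (Pi.single a 1) = g (Pi.single a 1)) (hb : f (Pi.single b 1) = g (Pi.single b 1))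
    (hc : f (Pi.single c 1) = g (Pi.single c 1)) (he : f (Pi.single e 1) = g (Pi.single e 1))
    (hz0 : f (Pi.single z0 1) = g (Pi.single z0 1))
    (hodd : ∀ s, ∀ j < k, f (zS (2 * k) s (2 * j + 1)) = g (zS (2 * k) s (2 * j + 1)))
    (heven : ∀ s, ∀ j < k, f (zS (2 * k) s (2 * j + 2)) = g (zS (2 * k) s (2 * j + 2))) :
    f = g := by
  refine (Pi.basisFun R2 (ModelB (2 * k))).ext fun i => ?_
  rw [Pi.basisFun_apply]
  obtain _ | _ | _ | _ | _ | ⟨s, r⟩ := i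
  · exact ha
  · exact hb
  · exact hc
  · exact he
  · exact hz0
  · rw [← zS_succ]
    obtain ⟨j, hj⟩ | ⟨j, hj⟩ := Nat.even_or_odd (r : ℕ)
    · rw [show (r : ℕ) + 1 = 2 * j + 1 by omega]
      exact hodd s j (by omega)
    · rw [show (r : ℕ) + 1 = 2 * j + 2 by omega]
      exact heven s j (by omega)

/-- There is a linear map with prescribed values on `c, e, z_0` and `z_r^s` for even `r`, and zero on
`a, b` and on `z_r^s` for odd `r`. -/
theorem exists_linearMap (k : ℕ) {P : Type*} [AddCommGroup P] [Module R2 P]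
    (pc pe p0 : P) (p : Fin 2 → ℕ → P) :
    ∃ f : (ModelB (2 * k) → R2) →ₗ[R2] P,
      f (Pi.single a 1) = 0 ∧ f (Pi.single b 1) = 0 ∧ f (Pi.single c 1) = pc ∧
      f (Pi.single e 1) = pe ∧ f (Pi.single z0 1) = p0 ∧
      (∀ s, ∀ j < k, f (zS (2 * k) s (2 * j + 1)) = 0) ∧
      (∀ s, ∀ j < k, f (zS (2 * k) s (2 * j + 2)) = p s j) := by
  let val : ModelB (2 * k) → P
    | a => 0
    | b => 0
    | c => pc
    | e => pe
    | z0 => p0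
    | z s r => if Even (r : ℕ) then 0 else p s (r / 2)
  have key : ∀ i, (Pi.basisFun R2 (ModelB (2 * k))).constr ℕ val (Pi.single i 1) = val i := by
    intro i
    rw [← Pi.basisFun_apply, Module.Basis.constr_basis]
  refine ⟨(Pi.basisFun R2 (ModelB (2 * k))).constr ℕ val, key _, key _, key _, key _, key _,
    fun s j hj => ?_, fun s j hj => ?_⟩
  · rw [zS_succ s (⟨2 * j, by omega⟩ : Fin (2 * k)), key]
    simp [val]
  · rw [show 2 * j + 2 = (2 * j + 1) + 1 by rfl,
      zS_succ s (⟨2 * j + 1, by omega⟩ : Fin (2 * k)), key]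
    simp only [val]
    rw [if_neg (by simp), show (2 * j + 1) / 2 = j by omega]

end ModelB

/-- Let `(M, ∂, ι)` be the dual model complex `C̄₁` with its involution (`v = 2k`, `k ≥ 1`),
and let `N = M ⊕ M` with differential `D (x, y) = (∂ x, (1 + ι) x + ∂ y)`. Then `D ∘ D = 0`
and the homology `ker D / range D` is a free `R2`-module of rank two. -/
theorem modelC1dual_cone_homology (k : ℕ) (hk : 1 ≤ k) (v : ℕ) (hv : v = 2 * k)
    (d ι : (ModelB v → R2) →ₗ[R2] (ModelB v → R2))
    -- the differential ∂ = d
    (hda : d (Pi.single ModelB.a 1) = Pi.single ModelB.b 1 + Pi.single ModelB.c 1)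
    (hdb : d (Pi.single ModelB.b 1) = U • (Pi.single ModelB.e 1 : ModelB v → R2))
    (hdc : d (Pi.single ModelB.c 1) = U • (Pi.single ModelB.e 1 : ModelB v → R2))
    (hdz1 : ∀ s : Fin 2, d (zS v s 1) = Pi.single ModelB.z0 1 + zS v s 2)
    (hdzodd : ∀ s : Fin 2, ∀ r : ℕ, 1 < r → r ≤ v - 1 → Odd r →
      d (zS v s r) = zS v s (r - 1) + zS v s (r + 1))
    (hde : d (Pi.single ModelB.e 1) = 0)
    (hdz0 : d (Pi.single ModelB.z0 1) = 0)
    (hdzeven : ∀ s : Fin 2, ∀ r : ℕ, 1 ≤ r → r ≤ v → Even r → d (zS v s r) = 0)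
    -- the involution ι
    (hia : ι (Pi.single ModelB.a 1) = Pi.single ModelB.a 1 + Pi.single ModelB.z0 1)
    (hib : ι (Pi.single ModelB.b 1) = Pi.single ModelB.c 1)
    (hic : ι (Pi.single ModelB.c 1) = Pi.single ModelB.b 1)
    (hie : ι (Pi.single ModelB.e 1) = Pi.single ModelB.e 1)
    (hiz0 : ι (Pi.single ModelB.z0 1) = Pi.single ModelB.z0 1 + Pi.single ModelB.e 1)
    (hiz11 : ι (zS v 0 1) = zS v 1 1 + Uinv • (Pi.single ModelB.c 1 : ModelB v → R2))
    (hiz12 : ι (zS v 1 1) = zS v 0 1 + Uinv • (Pi.single ModelB.b 1 : ModelB v → R2))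
    (hiz : ∀ r : ℕ, 2 ≤ r → r ≤ v → ι (zS v 0 r) = zS v 1 r ∧ ι (zS v 1 r) = zS v 0 r)
    -- the mapping cone differential D on N = M ⊕ M
    (D : ((ModelB v → R2) × (ModelB v → R2)) →ₗ[R2] ((ModelB v → R2) × (ModelB v → R2)))
    (hD : ∀ x y : ModelB v → R2, D (x, y) = (d x, x + ι x + d y)) :
    D ∘ₗ D = 0 ∧
    ∃ u w : (ModelB v → R2) × (ModelB v → R2),
      u ∈ LinearMap.ker D ∧ w ∈ LinearMap.ker D ∧
      (∀ x ∈ LinearMap.ker D, ∃ c₁ c₂ : R2, x + c₁ • u + c₂ • w ∈ LinearMap.range D) ∧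
      (∀ c₁ c₂ : R2, c₁ • u + c₂ • w ∈ LinearMap.range D → c₁ = 0 ∧ c₂ = 0) := by
  subst hv
  have hR2 : (2 : R2) = 0 := by
    rw [← map_ofNat (C : ZMod 2 →+* R2) 2, show (OfNat.ofNat 2 : ZMod 2) = 0 from rfl, map_zero]
  have h2 : ∀ x : ModelB (2 * k) → R2, x + x = 0 := fun x => by
    rw [← two_smul R2, hR2, zero_smul]
  have h2R : ∀ x : R2, x + x = 0 := fun x => by rw [← two_mul, hR2, zero_mul]
  have hUU : Uinv * U = 1 := by rw [Uinv, U, ← T_add]; simp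
  have hodd : ∀ s, ∀ j < k, d (zS (2 * k) s (2 * j + 1)) =
      (if j = 0 then Pi.single ModelB.z0 1 else zS (2 * k) s (2 * j)) +
        zS (2 * k) s (2 * j + 2) := by
    intro s j hj
    split_ifs with h0
    · subst h0; exact hdz1 s
    · exact hdzodd s (2 * j + 1) (by omega) (by omega) ⟨j, rfl⟩
  have heven : ∀ s, ∀ j < k, d (zS (2 * k) s (2 * j + 2)) = 0 := fun s j hj =>
    hdzeven s _ (by omega) (by omega) ⟨j + 1, by ring⟩
  have hιeven : ∀ s, ∀ j < k, ι (zS (2 * k) s (2 * j + 2)) = zS (2 * k) (1 - s) (2 * j + 2) := by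
    intro s j hj
    have := hiz (2 * j + 2) (by omega) (by omega)
    fin_cases s
    · exact this.1
    · exact this.2
  have hιodd : ∀ s, ∀ j < k, j ≠ 0 →
      ι (zS (2 * k) s (2 * j + 1)) = zS (2 * k) (1 - s) (2 * j + 1) := by
    intro s j hj h0
    have := hiz (2 * j + 1) (by omega) (by omega)
    fin_cases s
    · exact this.1
    · exact this.2
  obtain ⟨φ, φa, φb, φc, φe, φ0, φodd, φeven⟩ :=
    ModelB.exists_linearMap k (0 : R2) 0 1 (fun _ _ => 1)
  obtain ⟨h, ha, hb, hc, he, h0, hhodd, hheven⟩ :=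
    ModelB.exists_linearMap k (Pi.single ModelB.a 1 : ModelB (2 * k) → R2)
      (Uinv • Pi.single ModelB.b 1) 0
      (fun s j => ∑ i ∈ Finset.range (j + 1), zS (2 * k) s (2 * i + 1))
  have hdsum : ∀ s, ∀ j < k, d (∑ i ∈ Finset.range (j + 1), zS (2 * k) s (2 * i + 1)) =
      Pi.single ModelB.z0 1 + zS (2 * k) s (2 * j + 2) := by
    intro s j
    induction j with
    | zero => intro _; simpa using hdz1 s
    | succ j ih =>
      intro hj
      rw [Finset.sum_range_succ, map_add, ih (by omega), hodd s (j + 1) hj, if_neg (by omega),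
        show 2 * (j + 1) = 2 * j + 2 by ring, add_assoc, ← add_assoc (zS _ _ _), h2, zero_add]
  have hdd : d ∘ₗ d = 0 := by
    apply ModelB.linearMap_ext_s12
    · simp [hda, hdb, hdc, h2]
    · simp [hdb, hde]
    · simp [hdc, hde]
    · simp [hde]
    · simp [hdz0]
    · intro s j hj
      obtain _ | j := j
      · simp [hdz1, hdz0, heven s 0 hj]
      · have : d (zS (2 * k) s (2 * (j + 1))) = 0 := heven s j (by omega)
        simp [hodd s _ hj, heven s _ hj, this]
    · intro s j hj
      simp [heven s j hj]
  have hdι : d ∘ₗ ι = ι ∘ₗ d := by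
    apply ModelB.linearMap_ext_s12
    · simp [hia, hda, hib, hic, hdz0, add_comm]
    · simp [hib, hdb, hdc, hie]
    · simp [hic, hdb, hdc, hie]
    · simp [hie, hde]
    · simp [hiz0, hdz0, hde]
    · intro s j hj
      obtain _ | j := j
      · have h₂ := hιeven s 0 hj
        have hu : Uinv • U • (Pi.single ModelB.e 1 : ModelB (2 * k) → R2) =
            Pi.single ModelB.e 1 := by
          rw [smul_smul, hUU, one_smul]
        fin_cases s
        · simp only [Fin.zero_eta, mul_zero, zero_add, sub_zero, LinearMap.comp_apply] at h₂ ⊢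
          rw [hiz11, map_add, map_smul, hdc, hdz1, hdz1, map_add, hiz0, h₂, hu]
          abel
        · simp only [Fin.mk_one, mul_zero, zero_add, sub_self, LinearMap.comp_apply] at h₂ ⊢
          rw [hiz12, map_add, map_smul, hdb, hdz1, hdz1, map_add, hiz0, h₂, hu]
          abel
      · have : ι (zS (2 * k) s (2 * (j + 1))) = zS (2 * k) (1 - s) (2 * (j + 1)) :=
          hιeven s j (by omega)
        simp [hιodd s _ hj, hodd _ _ hj, hιeven s _ hj, this]
    · intro s j hj
      simp [hιeven s j hj, heven _ j hj]
  have hh : LinearMap.id + (d ∘ₗ h + h ∘ₗ d) = φ.smulRight (Pi.single ModelB.z0 1) := by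
    apply ModelB.linearMap_ext_s12
    · simp [ha, hda, hb, hc, φa, h2]
    · simp [hb, hdb, he, φb, smul_smul, mul_comm U, hUU, h2]
    · simp only [LinearMap.add_apply, LinearMap.comp_apply, LinearMap.id_apply,
        LinearMap.smulRight_apply, hc, hda, hdc, φc, map_smul, he, smul_smul, mul_comm U, hUU,
        one_smul, zero_smul]
      rw [show ∀ x y : ModelB (2 * k) → R2, y + (x + y + x) = (x + x) + (y + y) by
        intros; abel, h2, h2, add_zero]
    · simp [he, hdb, hde, φe, smul_smul, hUU, h2]
    · simp [h0, hdz0, φ0]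
    · intro s j hj
      simp only [LinearMap.add_apply, LinearMap.comp_apply, LinearMap.id_apply,
        LinearMap.smulRight_apply, hhodd s j hj, map_zero, zero_add, φodd s j hj, zero_smul,
        hodd s j hj, map_add, hheven s j hj]
      obtain _ | j := j
      · simp [h0, h2]
      · rw [if_neg (by omega), show 2 * (j + 1) = 2 * j + 2 by ring, hheven s j (by omega),
          Finset.sum_range_succ _ (j + 1), ← add_assoc (Finset.sum _ _), h2, zero_add]
        exact h2 _
    · intro s j hj
      simp only [LinearMap.add_apply, LinearMap.comp_apply, LinearMap.id_apply,
        LinearMap.smulRight_apply, hheven s j hj, hdsum s j hj, heven s j hj, map_zero, add_zero,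
        φeven s j hj, one_smul]
      rw [add_comm, add_assoc, h2, add_zero]
  have hφd : φ ∘ₗ d = 0 := by
    apply ModelB.linearMap_ext_s12
    · simp [hda, φb, φc]
    · simp [hdb, φe]
    · simp [hdc, φe]
    · simp [hde]
    · simp [hdz0]
    · intro s j hj
      obtain _ | j := j
      · have := φeven s 0 hj
        simp only [mul_zero, zero_add] at this
        simp [hdz1, φ0, this, h2R]
      · have : φ (zS (2 * k) s (2 * (j + 1))) = 1 := φeven s j (by omega)
        simp [hodd s _ hj, φeven s _ hj, this, h2R]
    · intro s j hj
      simp [heven s j hj]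
  have hφι : φ ∘ₗ (LinearMap.id + ι) = LinearMap.proj ModelB.b ∘ₗ d := by
    have hzb : ∀ s, ∀ j, zS (2 * k) s j ModelB.b = 0 := by
      intro s j
      unfold zS
      split_ifs <;> simp
    apply ModelB.linearMap_ext_s12
    · simp [hia, hda, φa, φ0]
    · simp [hib, hdb, φb, φc]
    · simp [hic, hdc, φb, φc]
    · simp [hie, hde, φe]
    · simp [hiz0, hdz0, φ0, φe, h2R]
    · intro s j hj
      have hr : (LinearMap.proj ModelB.b ∘ₗ d) (zS (2 * k) s (2 * j + 1)) = 0 := by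
        simp only [LinearMap.comp_apply, LinearMap.proj_apply, hodd s j hj, Pi.add_apply, hzb]
        split_ifs <;> simp [hzb]
      rw [hr]
      obtain _ | j := j
      · have h₀ := φodd 0 0 hj
        have h₁ := φodd 1 0 hj
        simp only [mul_zero, zero_add] at h₀ h₁
        fin_cases s
        · simp [hiz11, h₀, h₁, φc]
        · simp [hiz12, h₀, h₁, φb]
      · simp [hιodd s _ hj, φodd _ _ hj]
    · intro s j hj
      simp [hιeven s j hj, heven s j hj, φeven _ j hj, h2R]
  refine cone_homology_of_homotopy h2 d ι h φ (LinearMap.proj ModelB.b) (Pi.single ModelB.z0 1)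
    (Uinv • Pi.single ModelB.b 1) (LinearMap.congr_fun hdd) (LinearMap.congr_fun hdι)
    (LinearMap.congr_fun hh) (LinearMap.congr_fun hφd) φ0 hdz0 (LinearMap.congr_fun hφι) ?_ D hD
  rw [hiz0, map_smul, hdb, smul_smul, hUU, one_smul, ← add_assoc, h2, zero_add, h2]
end

section
/- Let k ≥ 2, v = 2k, and S = F_2[U]. Let A be the free S-module with basis {a, b, c, e, z_0} ∪ {w_r^s : 1 ≤ r ≤ v, s ∈ {1,2}}, with S-linear differential ∂ given by ∂a = b + c, ∂b = ∂c = U·e, ∂w_1^s = U·z_0 + w_2^s, ∂w_r^s = U·w_{r-1}^s + w_{r+1}^s for odd r with 3 ≤ r ≤ v-3, ∂w_{v-1}^s = U²·w_{v-2}^s + w_v^s, and ∂ = 0 otherwise. Let ι : A → A be the S-linear map ι(a) = a + z_0, ι(b) = c, ι(c) = b, ι(e) = e, ι(z_0) = z_0 + e, ι(w_1^1) = w_1^2 + c, ι(w_1^2) = w_1^1 + b, and ι(w_r^1) = w_r^2, ι(w_r^2) = w_r^1 for 2 ≤ r ≤ v. Let N = A ⊕ A with S-linear differential D(x, y) = (∂x,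 (1 + ι)(x) + ∂y). Then D ∘ D = 0 and the homology ker(D)/range(D) is isomorphic as an S-module to F_2[U] ⊕ F_2[U] ⊕ F_2[U]/(U). -/
/- The involutive complex AI₀⁻ for the dual model complex C̄₁ has homology
F₂[U] ⊕ F₂[U] ⊕ F₂[U]/(U). -/

/-- `S2` is the polynomial ring `F₂[U]` (with `U = Polynomial.X`). -/
abbrev S2 : Type := Polynomial (ZMod 2)

/-- Basis `{a, b, c, e, z_0} ∪ {w_r^s : 1 ≤ r ≤ v, s ∈ {1,2}}` of the subcomplex `A₀⁻`
of the dual model complex `C̄₁`. -/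
inductive AB (v : ℕ) : Type
  | a | b | c | e | z0 | w (s : Fin 2) (r : Fin v)
  deriving DecidableEq

/-- The basis vector `w_r^{s+1}` for `1 ≤ r ≤ v`, extended by `0` outside that range. -/
noncomputable def wS (v : ℕ) (s : Fin 2) (r : ℕ) : AB v → S2 :=
  if h : 1 ≤ r ∧ r ≤ v then Pi.single (AB.w s ⟨r - 1, by omega⟩) 1 else 0

/-- A linear equivalence `ker D / range D ≃ Q` from a linear map that kills boundaries, is
surjective on cycles, and whose only cycles in the kernel are boundaries. -/
theorem nonempty_homology_equiv {R N Q : Type*} [CommRing R] [AddCommGroup N] [Module R N]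
    [AddCommGroup Q] [Module R Q] (D : N →ₗ[R] N) (F : N →ₗ[R] Q)
    (hFD : ∀ n, F (D n) = 0) (hsurj : ∀ t, ∃ n, D n = 0 ∧ F n = t)
    (hexact : ∀ n, D n = 0 → F n = 0 → ∃ m, D m = n) :
    Nonempty ((↥(LinearMap.ker D) ⧸
      Submodule.comap (LinearMap.ker D).subtype (LinearMap.range D)) ≃ₗ[R] Q) := by
  have hker : Submodule.comap (LinearMap.ker D).subtype (LinearMap.range D) =
      LinearMap.ker (F ∘ₗ (LinearMap.ker D).subtype) := by
    ext ⟨n, hn⟩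
    simp only [Submodule.mem_comap, Submodule.subtype_apply, LinearMap.mem_range,
      LinearMap.mem_ker, LinearMap.comp_apply]
    refine ⟨?_, fun h => hexact n hn h⟩
    rintro ⟨m, rfl⟩
    exact hFD m
  refine ⟨(Submodule.quotEquivOfEq _ _ hker).trans
    (LinearMap.quotKerEquivOfSurjective _ fun t => ?_)⟩
  obtain ⟨n, hn, rfl⟩ := hsurj t
  exact ⟨⟨n, hn⟩, rfl⟩

theorem S2.add_self {M : Type*} [AddCommGroup M] [Module S2 M] (x : M) : x + x = 0 := by
  simpa [CharTwo.two_eq_zero] using (two_smul S2 x).symm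

theorem S2.eq_of_add_eq_zero {M : Type*} [AddCommGroup M] [Module S2 M] {x y : M}
    (h : x + y = 0) : x = y := by
  rw [← add_zero x, ← S2.add_self y, ← add_assoc, h, zero_add]

theorem S2.add_self_left {M : Type*} [AddCommGroup M] [Module S2 M] (x y : M) :
    x + (x + y) = y := by
  rw [← add_assoc, S2.add_self, zero_add]

open Polynomial in
/-- The homology of the mapping cone of `1 + ι` on a complex `(A, d)` that `h` contracts onto
the span of `z₀`, `e₀`, `b₀`, where `d b₀ = X • e₀` and `(1 + ι) z₀ = e₀`. The functionals
`z`, `e`, `a`, `b`, `bc`, `q` describe the contraction; `z + X • q` is the class along `z₀`. -/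
theorem cone_homology {A : Type*} [AddCommGroup A] [Module S2 A] (d ι h : A →ₗ[S2] A)
    (z e a b bc q : A →ₗ[S2] S2) (b₀ e₀ z₀ : A)
    (hcomm : ∀ x, d (ι x) = ι (d x))
    (hed : ∀ x, e (d x) = X * bc x) (hei : ∀ x, e (x + ι x) = z x)
    (hbcd : ∀ x, bc (d x) = 0) (hbd : ∀ x, b (d x) = a x)
    (hbci : ∀ x, bc (x + ι x) + q (d x) = 0)
    (hpd : ∀ x, z (d x) + X * q (d x) = 0)
    (hpi : ∀ x, z (x + ι x) + X * q (x + ι x) = a x)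
    (hh : ∀ x, x = d (h x) + h (d x) + (z x + X * q x) • z₀ + bc x • b₀ + e x • e₀)
    (hdz : d z₀ = 0) (hde : d e₀ = 0) (hdb : d b₀ = (X : S2) • e₀)
    (hiz : z₀ + ι z₀ = e₀) (hie : e₀ + ι e₀ = 0)
    (hzz : z z₀ = 1) (hzb : z b₀ = 0) (hqz : q z₀ = 0) (hqe : q e₀ = 0)
    (hqb : q b₀ = 0) (hbcz : bc z₀ = 0) (hbcb : bc b₀ = 1) (hbz : b z₀ = 0)
    (hbe : b e₀ = 0) (hee : e e₀ = 1) (hez : e z₀ = 0)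
    (D : (A × A) →ₗ[S2] (A × A)) (hD : ∀ x y : A, D (x, y) = (d x, x + ι x + d y)) :
    Nonempty ((↥(LinearMap.ker D) ⧸
      Submodule.comap (LinearMap.ker D).subtype (LinearMap.range D)) ≃ₗ[S2]
      (S2 × S2 × (S2 ⧸ Submodule.span S2 {(X : S2)}))) := by
  let F : (A × A) →ₗ[S2] (S2 × S2 × (S2 ⧸ Submodule.span S2 {(X : S2)})) :=
    (bc ∘ₗ LinearMap.snd S2 A A + q ∘ₗ LinearMap.fst S2 A A).prod
      (((z + (X : S2) • q) ∘ₗ LinearMap.snd S2 A A + b ∘ₗ LinearMap.fst S2 A A).prod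
        ((Submodule.mkQ _ ∘ₗ e) ∘ₗ LinearMap.fst S2 A A))
  have hF (x y : A) : F (x, y) =
      (bc y + q x, z y + X * q y + b x, Submodule.Quotient.mk (e x)) := rfl
  refine nonempty_homology_equiv D F ?_ ?_ ?_
  · rintro ⟨x, y⟩
    rw [hD, hF, Prod.mk_eq_zero, Prod.mk_eq_zero, Submodule.Quotient.mk_eq_zero,
      Submodule.mem_span_singleton]
    refine ⟨?_, ?_, bc x, ?_⟩
    · rw [map_add bc, hbcd, add_zero, hbci]
    · linear_combination hpi x + hpd y + hbd x + S2.add_self (a x) + map_add z (x + ι x) (d y)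
        + X * map_add q (x + ι x) (d y)
    · rw [hed, smul_eq_mul, mul_comm]
  · rintro ⟨f, g, t⟩
    obtain ⟨t, rfl⟩ := Submodule.Quotient.mk_surjective _ t
    refine ⟨((X * f) • z₀ + t • e₀, f • b₀ + g • z₀), ?_, ?_⟩
    · rw [hD, Prod.mk_eq_zero]
      refine ⟨by simp [hdz, hde], ?_⟩
      have : (X * f) • z₀ + t • e₀ + ι ((X * f) • z₀ + t • e₀) + d (f • b₀ + g • z₀) =
          (X * f) • (z₀ + ι z₀) + t • (e₀ + ι e₀) + f • d b₀ + g • d z₀ := by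
        simp only [map_add, map_smul]; module
      rw [this, hiz, hie, hdb, hdz, smul_zero, smul_zero, add_zero, add_zero, smul_smul,
        mul_comm, S2.add_self]
    · rw [hF]
      simp [hzz, hzb, hqz, hqe, hqb, hbcz, hbcb, hbz, hbe, hee, hez]
  · rintro ⟨x, y⟩ hcyc hFz
    rw [hD, Prod.mk_eq_zero] at hcyc
    rw [hF, Prod.mk_eq_zero, Prod.mk_eq_zero, Submodule.Quotient.mk_eq_zero,
      Submodule.mem_span_singleton] at hFz
    obtain ⟨hdx, hxy⟩ := hcyc
    obtain ⟨hf, hg, t, ht⟩ := hFz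
    have hbc_of_cycle (x : A) (hx : d x = 0) : bc x = 0 := by
      have := hed x
      rw [hx, map_zero] at this
      exact (mul_eq_zero.mp this.symm).resolve_left X_ne_zero
    have hzx : z x = X * bc y := by
      have := congrArg e hxy
      rw [map_add, hei, hed, map_zero] at this
      exact S2.eq_of_add_eq_zero this
    have hx : x = d (h x + t • b₀) := by
      conv_lhs => rw [hh x, hdx, hbc_of_cycle x hdx, hzx, ← mul_add, hf, ← ht]
      rw [map_add, map_smul, hdb, smul_smul, smul_eq_mul]
      simp
    generalize h x + t • b₀ = u at hx
    have hdy' : d (y + (u + ι u)) = 0 := by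
      rw [map_add, map_add, hcomm, ← hx, add_comm, hxy]
    have hpy' : z (y + (u + ι u)) + X * q (y + (u + ι u)) = 0 := by
      have hbx := hbd u
      rw [← hx] at hbx
      linear_combination map_add z y (u + ι u) + X * map_add q y (u + ι u) + hg + hpi u - hbx
    have hy' := hh (y + (u + ι u))
    rw [hdy', hpy', hbc_of_cycle _ hdy', map_zero, zero_smul, zero_smul, add_zero, add_zero,
      add_zero] at hy'
    generalize h (y + (u + ι u)) = w, e (y + (u + ι u)) = g at hy'
    refine ⟨(u + g • z₀, w), ?_⟩
    rw [hD, Prod.mk_inj]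
    refine ⟨by rw [map_add, map_smul, hdz, smul_zero, add_zero, hx], ?_⟩
    have : u + g • z₀ + ι (u + g • z₀) + d w = (u + ι u) + (d w + g • (z₀ + ι z₀)) := by
      simp only [map_add, map_smul]; module
    rw [this, hiz, ← hy', add_left_comm, S2.add_self, add_zero]

instance (v : ℕ) : Finite (AB v) := by
  refine Finite.of_injective
    (β := Fin 5 ⊕ Fin 2 × Fin v)
    (fun | .a => .inl 0 | .b => .inl 1 | .c => .inl 2 | .e => .inl 3 | .z0 => .inl 4
         | .w s r => .inr (s, r)) ?_
  rintro (_ | _ | _ | _ | _ | _) (_ | _ | _ | _ | _ | _) <;> simp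

theorem wS_of_le {v r : ℕ} (s : Fin 2) (h₁ : 1 ≤ r) (h₂ : r ≤ v) :
    wS v s r = Pi.single (AB.w s ⟨r - 1, by omega⟩) 1 :=
  dif_pos ⟨h₁, h₂⟩

/-- The basis vector `w_{2j+1}` of the free module on `AB (2 * k)`, for `j < k`. -/
noncomputable def wOdd (k : ℕ) (s : Fin 2) (j : ℕ) : AB (2 * k) → S2 := wS (2 * k) s (2 * j + 1)

/-- The basis vector `w_{2j+2}` of the free module on `AB (2 * k)`, for `j < k`. -/
noncomputable def wEven (k : ℕ) (s : Fin 2) (j : ℕ) : AB (2 * k) → S2 := wS (2 * k) s (2 * j + 2)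

/-- Linear maps out of the free module on `AB (2 * k)` are determined by their values on the
basis vectors, with the `w_r` split by the parity of `r`. -/
theorem AB.linearMap_ext {k : ℕ} {M : Type*} [AddCommGroup M] [Module S2 M]
    {f g : (AB (2 * k) → S2) →ₗ[S2] M}
    (ha : f (Pi.single .a 1) = g (Pi.single .a 1)) (hb : f (Pi.single .b 1) = g (Pi.single .b 1))
    (hc : f (Pi.single .c 1) = g (Pi.single .c 1)) (he : f (Pi.single .e 1) = g (Pi.single .e 1))
    (hz : f (Pi.single .z0 1) = g (Pi.single .z0 1))
    (hodd : ∀ s, ∀ j < k, f (wOdd k s j) = g (wOdd k s j))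
    (heven : ∀ s, ∀ j < k, f (wEven k s j) = g (wEven k s j)) :
    f = g := by
  refine (Pi.basisFun S2 (AB (2 * k))).ext fun i => ?_
  rw [Pi.basisFun_apply]
  match i with
  | .a => exact ha
  | .b => exact hb
  | .c => exact hc
  | .e => exact he
  | .z0 => exact hz
  | .w s ⟨r, hr⟩ =>
    have h : (Pi.single (AB.w s ⟨r, hr⟩) 1 : AB (2 * k) → S2) = wS (2 * k) s (r + 1) :=
      (wS_of_le (r := r + 1) s (by omega) (by omega)).symm
    rw [h]
    obtain ⟨j, rfl | rfl⟩ := Nat.even_or_odd' r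
    · exact hodd s j (by omega)
    · exact heven s j (by omega)

/-- A linear map out of the free module on `AB (2 * k)` with prescribed values on the basis
vectors, with the `w_r` split by the parity of `r`. -/
theorem AB.exists_linearMap {k : ℕ} {M : Type*} [AddCommGroup M] [Module S2 M]
    (a b c e z : M) (wodd weven : Fin 2 → ℕ → M) :
    ∃ f : (AB (2 * k) → S2) →ₗ[S2] M,
      f (Pi.single .a 1) = a ∧ f (Pi.single .b 1) = b ∧ f (Pi.single .c 1) = c ∧
      f (Pi.single .e 1) = e ∧ f (Pi.single .z0 1) = z ∧
      (∀ s, ∀ j < k, f (wOdd k s j) = wodd s j) ∧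
      (∀ s, ∀ j < k, f (wEven k s j) = weven s j) := by
  let φ : AB (2 * k) → M
    | .a => a
    | .b => b
    | .c => c
    | .e => e
    | .z0 => z
    | .w s r => if Even r.val then wodd s (r / 2) else weven s (r / 2)
  have h (i : AB (2 * k)) : (Pi.basisFun S2 (AB (2 * k))).constr S2 φ (Pi.single i 1) = φ i := by
    rw [← Pi.basisFun_apply, Module.Basis.constr_basis]
  refine ⟨(Pi.basisFun S2 (AB (2 * k))).constr S2 φ, h _, h _, h _, h _, h _, ?_, ?_⟩
  · intro s j hj
    rw [wOdd, wS_of_le s (by omega) (by omega), h]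
    simp [φ]
  · intro s j hj
    rw [wEven, wS_of_le s (by omega) (by omega), h]
    simp [φ, show (2 * j + 1) / 2 = j by omega]

/-- The coefficient of `w_{2j}` in `∂ w_{2j+1}` for `1 ≤ j < k`. -/
noncomputable def stepCoeff (k j : ℕ) : S2 :=
  if j + 1 = k then Polynomial.X ^ 2 else Polynomial.X

/-- The class of `w_{2j+2}` is `U * evenWeight k j` times the class of `z_0`. -/
noncomputable def evenWeight (k : ℕ) : ℕ → S2
  | 0 => 1
  | j + 1 => stepCoeff k (j + 1) * evenWeight k j

/-- The contracting homotopy at `w_{2j+2}`: a combination of the `w_{2i+1}`, `i ≤ j`, whose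
boundary is the sum of `w_{2j+2}` and a multiple of `z_0`. -/
noncomputable def evenHomotopy (k : ℕ) (s : Fin 2) : ℕ → (AB (2 * k) → S2)
  | 0 => wOdd k s 0
  | j + 1 => wOdd k s (j + 1) + stepCoeff k (j + 1) • evenHomotopy k s j

set_option maxHeartbeats 1000000 in
/-- Let `A` be the free `F₂[U]`-module on `{a, b, c, e, z_0} ∪ {w_r^s : 1 ≤ r ≤ v, s ∈ {1,2}}`
(`v = 2k`, `k ≥ 2`) with differential `∂a = b + c`, `∂b = ∂c = U • e`,
`∂w_1^s = U • z_0 + w_2^s`, `∂w_r^s = U • w_{r-1}^s + w_{r+1}^s` for odd `r` with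
`3 ≤ r ≤ v - 3`, `∂w_{v-1}^s = U² • w_{v-2}^s + w_v^s`, and `∂ = 0` otherwise, and let `ι`
be the `F₂[U]`-linear map with `ι a = a + z_0`, `ι b = c`, `ι c = b`, `ι e = e`,
`ι z_0 = z_0 + e`, `ι w_1^1 = w_1^2 + c`, `ι w_1^2 = w_1^1 + b`, and `ι w_r^1 = w_r^2`,
`ι w_r^2 = w_r^1` for `2 ≤ r ≤ v`. Let `N = A ⊕ A` with differential
`D (x, y) = (∂ x, (1 + ι) x + ∂ y)`. Then `D ∘ D = 0` and the homology `ker D / range D`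
is isomorphic as an `F₂[U]`-module to `F₂[U] ⊕ F₂[U] ⊕ F₂[U]/(U)`. -/
theorem modelC1dual_AIminus_homology (k : ℕ) (hk : 2 ≤ k) (v : ℕ) (hv : v = 2 * k)
    (d ι : (AB v → S2) →ₗ[S2] (AB v → S2))
    -- the differential ∂ = d
    (hda : d (Pi.single AB.a 1) = Pi.single AB.b 1 + Pi.single AB.c 1)
    (hdb : d (Pi.single AB.b 1) = (Polynomial.X : S2) • (Pi.single AB.e 1 : AB v → S2))
    (hdc : d (Pi.single AB.c 1) = (Polynomial.X : S2) • (Pi.single AB.e 1 : AB v → S2))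
    (hdw1 : ∀ s : Fin 2, d (wS v s 1) =
      (Polynomial.X : S2) • (Pi.single AB.z0 1 : AB v → S2) + wS v s 2)
    (hdwodd : ∀ s : Fin 2, ∀ r : ℕ, 3 ≤ r → r ≤ v - 3 → Odd r →
      d (wS v s r) = (Polynomial.X : S2) • wS v s (r - 1) + wS v s (r + 1))
    (hdwv1 : ∀ s : Fin 2, d (wS v s (v - 1)) =
      ((Polynomial.X : S2) ^ 2) • wS v s (v - 2) + wS v s v)
    (hde : d (Pi.single AB.e 1) = 0)
    (hdz0 : d (Pi.single AB.z0 1) = 0)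
    (hdweven : ∀ s : Fin 2, ∀ r : ℕ, 1 ≤ r → r ≤ v → Even r → d (wS v s r) = 0)
    -- the involution ι
    (hia : ι (Pi.single AB.a 1) = Pi.single AB.a 1 + Pi.single AB.z0 1)
    (hib : ι (Pi.single AB.b 1) = Pi.single AB.c 1)
    (hic : ι (Pi.single AB.c 1) = Pi.single AB.b 1)
    (hie : ι (Pi.single AB.e 1) = Pi.single AB.e 1)
    (hiz0 : ι (Pi.single AB.z0 1) = Pi.single AB.z0 1 + Pi.single AB.e 1)
    (hiw11 : ι (wS v 0 1) = wS v 1 1 + Pi.single AB.c 1)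
    (hiw12 : ι (wS v 1 1) = wS v 0 1 + Pi.single AB.b 1)
    (hiw : ∀ r : ℕ, 2 ≤ r → r ≤ v → ι (wS v 0 r) = wS v 1 r ∧ ι (wS v 1 r) = wS v 0 r)
    -- the mapping cone differential D on N = A ⊕ A
    (D : ((AB v → S2) × (AB v → S2)) →ₗ[S2] ((AB v → S2) × (AB v → S2)))
    (hD : ∀ x y : AB v → S2, D (x, y) = (d x, x + ι x + d y)) :
    D ∘ₗ D = 0 ∧
    Nonempty (
      (↥(LinearMap.ker D) ⧸
        Submodule.comap (LinearMap.ker D).subtype (LinearMap.range D)) ≃ₗ[S2]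
      (S2 × S2 × (S2 ⧸ Submodule.span S2 {(Polynomial.X : S2)}))) := by
  subst hv
  have hdw0 (s : Fin 2) : d (wOdd k s 0) =
      (Polynomial.X : S2) • Pi.single AB.z0 1 + wEven k s 0 := hdw1 s
  have hdwsucc (s : Fin 2) (j : ℕ) (hj : j + 1 < k) : d (wOdd k s (j + 1)) =
      stepCoeff k (j + 1) • wEven k s j + wEven k s (j + 1) := by
    unfold stepCoeff
    split_ifs with h
    · unfold wOdd wEven
      convert hdwv1 s using 3 <;> congr 1 <;> omega
    · exact hdwodd s (2 * (j + 1) + 1) (by omega) (by omega) ⟨j + 1, rfl⟩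
  have hdweven' (s : Fin 2) (j : ℕ) (hj : j < k) : d (wEven k s j) = 0 :=
    hdweven s _ (by omega) (by omega) ⟨j + 1, by omega⟩
  have hiwodd (j : ℕ) (hj : j + 1 < k) : ι (wOdd k 0 (j + 1)) = wOdd k 1 (j + 1) ∧
      ι (wOdd k 1 (j + 1)) = wOdd k 0 (j + 1) :=
    hiw (2 * (j + 1) + 1) (by omega) (by omega)
  have hiweven (j : ℕ) (hj : j < k) : ι (wEven k 0 j) = wEven k 1 j ∧
      ι (wEven k 1 j) = wEven k 0 j :=
    hiw (2 * j + 2) (by omega) (by omega)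
  have hiw0 : ι (wOdd k 0 0) = wOdd k 1 0 + Pi.single AB.c 1 := hiw11
  have hiw1 : ι (wOdd k 1 0) = wOdd k 0 0 + Pi.single AB.b 1 := hiw12
  clear hdw1 hdwodd hdwv1 hdweven hiw hiw11 hiw12
  have hdd : d ∘ₗ d = 0 := by
    apply AB.linearMap_ext
    case hodd =>
      rintro s (_ | j) hj
      · simp [hdw0, hdz0, hdweven' s 0 hj]
      · simp [hdwsucc s j hj, hdweven' s j (by omega), hdweven' s (j + 1) hj]
    case heven => exact fun s j hj => by simp [hdweven' s j hj]
    all_goals simp [hda, hdb, hdc, hde, hdz0, S2.add_self]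
  have hcomm : d ∘ₗ ι = ι ∘ₗ d := by
    apply AB.linearMap_ext
    case hodd =>
      rintro s (_ | j) hj <;> fin_cases s
      · simp [hiw0, hdw0, hdc, hiz0, hiweven 0 hj, add_right_comm]
      · simp [hiw1, hdw0, hdb, hiz0, hiweven 0 hj, add_right_comm]
      all_goals
        simp [hdwsucc _ j hj, hiwodd j hj, hiweven j (by omega), hiweven (j + 1) hj]
    case heven => exact fun s j hj => by fin_cases s <;> simp [hdweven' _ j hj, hiweven j hj]
    all_goals simp [hda, hdb, hdc, hde, hdz0, hia, hib, hic, hie, hiz0, add_comm]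
  refine ⟨?_, ?_⟩
  · refine LinearMap.ext fun ⟨x, y⟩ => ?_
    have hx := LinearMap.congr_fun hdd x
    have hy := LinearMap.congr_fun hdd y
    have hxi := LinearMap.congr_fun hcomm x
    simp only [LinearMap.comp_apply, LinearMap.zero_apply] at hx hy hxi
    simp [hD, hx, hy, hxi, S2.add_self]
  obtain ⟨z, hza, hzb, hzc, hze, hzz, hzo, hzw⟩ :=
    AB.exists_linearMap (k := k) (M := S2) 0 0 0 0 1 (fun _ _ => 0) (fun _ _ => 0)
  obtain ⟨e, hea, heb, hec, hee, hez, heo, hew⟩ :=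
    AB.exists_linearMap (k := k) (M := S2) 0 0 0 1 0 (fun _ _ => 0) (fun _ _ => 0)
  obtain ⟨a, haa, hab, hac, hae, haz, hao, haw⟩ :=
    AB.exists_linearMap (k := k) (M := S2) 1 0 0 0 0 (fun _ _ => 0) (fun _ _ => 0)
  obtain ⟨b, hba, hbb, hbc, hbe, hbz, hbo, hbw⟩ :=
    AB.exists_linearMap (k := k) (M := S2) 0 1 0 0 0 (fun _ _ => 0) (fun _ _ => 0)
  obtain ⟨bc, hbca, hbcb, hbcc, hbce, hbcz, hbco, hbcw⟩ :=
    AB.exists_linearMap (k := k) (M := S2) 0 1 1 0 0 (fun _ _ => 0) (fun _ _ => 0)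
  obtain ⟨q, hqa, hqb, hqc, hqe, hqz, hqo, hqw⟩ :=
    AB.exists_linearMap (k := k) (M := S2) 0 0 0 0 0 (fun _ _ => 0) (fun _ j => evenWeight k j)
  obtain ⟨h, hha, hhb, hhc, hhe, hhz, hho, hhw⟩ :=
    AB.exists_linearMap (k := k) 0 0 (Pi.single AB.a 1) 0 0 (fun _ _ => 0) (evenHomotopy k)
  have hed : e ∘ₗ d = (Polynomial.X : S2) • bc := by
    apply AB.linearMap_ext
    case hodd =>
      rintro s (_ | j) hj
      · simp [hdw0, hez, hew s 0 hj, hbco s 0 hj]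
      · simp [hdwsucc s j hj, hew s j (by omega), hew s (j + 1) hj, hbco s (j + 1) hj]
    case heven => exact fun s j hj => by simp [hdweven' s j hj, hbcw s j hj]
    all_goals simp [hda, hdb, hdc, hde, hdz0, heb, hec, hee, hbca, hbcb, hbcc, hbce, hbcz]
  have hbcd : bc ∘ₗ d = 0 := by
    apply AB.linearMap_ext
    case hodd =>
      rintro s (_ | j) hj
      · simp [hdw0, hbcz, hbcw s 0 hj]
      · simp [hdwsucc s j hj, hbcw s j (by omega), hbcw s (j + 1) hj]
    case heven => exact fun s j hj => by simp [hdweven' s j hj]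
    all_goals simp [hda, hdb, hdc, hde, hdz0, hbcb, hbcc, hbce, S2.add_self]
  have hbd : b ∘ₗ d = a := by
    apply AB.linearMap_ext
    case hodd =>
      rintro s (_ | j) hj
      · simp [hdw0, hbz, hbw s 0 hj, hao s 0 hj]
      · simp [hdwsucc s j hj, hbw s j (by omega), hbw s (j + 1) hj, hao s (j + 1) hj]
    case heven => exact fun s j hj => by simp [hdweven' s j hj, haw s j hj]
    all_goals simp [hda, hdb, hdc, hde, hdz0, hbb, hbc, hbe, haa, hab, hac, hae, haz]
  have hpd : (z + (Polynomial.X : S2) • q) ∘ₗ d = 0 := by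
    apply AB.linearMap_ext
    case hodd =>
      rintro s (_ | j) hj
      · simp [hdw0, hzz, hqz, hzw s 0 hj, hqw s 0 hj, evenWeight, S2.add_self]
      · simp [hdwsucc s j hj, hzw s j (by omega), hzw s (j + 1) hj, hqw s j (by omega),
          hqw s (j + 1) hj, evenWeight, S2.add_self]
    case heven => exact fun s j hj => by simp [hdweven' s j hj]
    all_goals simp [hda, hdb, hdc, hde, hdz0, hzb, hzc, hze, hqb, hqc, hqe]
  have hei : e ∘ₗ (LinearMap.id + ι) = z := by
    apply AB.linearMap_ext
    case hodd =>
      rintro s (_ | j) hj <;> fin_cases s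
      · simp [hiw0, hec, heo _ 0 hj, hzo _ 0 hj]
      · simp [hiw1, heb, heo _ 0 hj, hzo _ 0 hj]
      all_goals simp [hiwodd j hj, heo _ (j + 1) hj, hzo _ (j + 1) hj]
    case heven =>
      exact fun s j hj => by fin_cases s <;> simp [hiweven j hj, hew _ j hj, hzw _ j hj]
    all_goals simp [hia, hib, hic, hie, hiz0, hea, heb, hec, hee, hez, hza, hzb, hzc, hze, hzz,
      S2.add_self]
  have hbci : bc ∘ₗ (LinearMap.id + ι) + q ∘ₗ d = 0 := by
    apply AB.linearMap_ext
    case hodd =>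
      rintro s (_ | j) hj <;> fin_cases s
      · simp [hiw0, hdw0, hbcc, hbco _ 0 hj, hqz, hqw _ 0 hj, evenWeight, S2.add_self]
      · simp [hiw1, hdw0, hbcb, hbco _ 0 hj, hqz, hqw _ 0 hj, evenWeight, S2.add_self]
      all_goals simp [hiwodd j hj, hdwsucc _ j hj, hbco _ (j + 1) hj, hqw _ j (by omega),
        hqw _ (j + 1) hj, evenWeight, S2.add_self]
    case heven =>
      exact fun s j hj => by
        fin_cases s <;> simp [hiweven j hj, hbcw _ j hj, hdweven' _ j hj]
    all_goals simp [hia, hib, hic, hie, hiz0, hda, hdb, hdc, hde, hdz0, hbca, hbcb, hbcc, hbce,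
      hbcz, hqb, hqc, hqe, S2.add_self]
  have hpi : (z + (Polynomial.X : S2) • q) ∘ₗ (LinearMap.id + ι) = a := by
    apply AB.linearMap_ext
    case hodd =>
      rintro s (_ | j) hj <;> fin_cases s
      · simp [hiw0, hzo _ 0 hj, hqo _ 0 hj, hao _ 0 hj, hzc, hqc]
      · simp [hiw1, hzo _ 0 hj, hqo _ 0 hj, hao _ 0 hj, hzb, hqb]
      all_goals simp [hiwodd j hj, hzo _ (j + 1) hj, hqo _ (j + 1) hj, hao _ (j + 1) hj]
    case heven =>
      exact fun s j hj => by
        fin_cases s <;> simp [hiweven j hj, hzw _ j hj, hqw _ j hj, haw _ j hj, S2.add_self]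
    all_goals simp [hia, hib, hic, hie, hiz0, hza, hzb, hzc, hze, hzz, hqa, hqb, hqc, hqe, hqz,
      haa, hab, hac, hae, haz, S2.add_self]
  have hdh (s : Fin 2) (j : ℕ) (hj : j < k) : wEven k s j =
      d (evenHomotopy k s j) +
        (Polynomial.X * evenWeight k j : S2) • (Pi.single AB.z0 1 : AB (2 * k) → S2) := by
    induction j with
    | zero =>
      simp [evenHomotopy, evenWeight, hdw0, add_left_comm, add_comm, S2.add_self]
    | succ j ih =>
      rw [evenHomotopy, evenWeight, map_add, map_smul, hdwsucc s j hj, mul_left_comm, mul_smul]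
      conv_rhs => rw [ih (by omega)]
      simp only [smul_add, add_comm, add_left_comm, S2.add_self, add_zero]
  have hh : LinearMap.id = d ∘ₗ h + h ∘ₗ d +
      (z + (Polynomial.X : S2) • q).smulRight (Pi.single AB.z0 1) +
      bc.smulRight (Pi.single AB.b 1) + e.smulRight (Pi.single AB.e 1) := by
    apply AB.linearMap_ext
    case hodd =>
      rintro s (_ | j) hj
      · simp [hho s 0 hj, hdw0, hhz, hhw s 0 hj, hzo s 0 hj, hqo s 0 hj, hbco s 0 hj, heo s 0 hj,
          evenHomotopy]
      · simp [hho s (j + 1) hj, hdwsucc s j hj, hhw s j (by omega), hhw s (j + 1) hj,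
          hzo s (j + 1) hj, hqo s (j + 1) hj, hbco s (j + 1) hj, heo s (j + 1) hj,
          evenHomotopy, add_comm, add_left_comm, S2.add_self]
    case heven =>
      intro s j hj
      simpa [hhw s j hj, hdweven' s j hj, hzw s j hj, hqw s j hj, hbcw s j hj, hew s j hj]
        using hdh s j hj
    all_goals simp [hda, hdb, hdc, hde, hdz0, hha, hhb, hhc, hhe, hhz, hza, hzb, hzc, hze, hzz,
      hqa, hqb, hqc, hqe, hqz, hbca, hbcb, hbcc, hbce, hbcz, hea, heb, hec, hee, hez,
      add_comm, S2.add_self_left]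
  exact cone_homology d ι h z e a b bc q (Pi.single .b 1) (Pi.single .e 1) (Pi.single .z0 1)
    (LinearMap.congr_fun hcomm) (LinearMap.congr_fun hed) (LinearMap.congr_fun hei)
    (LinearMap.congr_fun hbcd) (LinearMap.congr_fun hbd) (LinearMap.congr_fun hbci)
    (LinearMap.congr_fun hpd) (LinearMap.congr_fun hpi) (LinearMap.congr_fun hh)
    hdz0 hde hdb (by rw [hiz0, S2.add_self_left]) (by rw [hie, S2.add_self])
    hzz hzb hqz hqe hqb hbcz hbcb hbz hbe hee hez D hD
end
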